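/- arXiv:1811.08341 — 4 statements merged into one kernel-verified Lean document; each statement's English description precedes it below -/
import Mathlib

section
/- For every positive integer n there exist nonnegative integers x, y, z, w and a prime p such that n = x^2 + y^2 + z^2 + 2w^2 and x + 2y = p. -/
section ChebyshevBounds

open Chebyshev ArithmeticFunction
open scoped Nat

lemma mul_log_sub_le_log_factorial {n : ℕ} (hn : 1 ≤ n) :
    (n : ℝ) * Real.log n - n + 1 ≤ Real.log (n ! : ℕ) ∧
      Real.log (n ! : ℕ) ≤ (n : ℝ) * Real.log n - n + 1 + Real.log n := by
  induction n, hn using Nat.le_induction with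
  | base => simp
  | succ n hn ih =>
    have h0 : (0 : ℝ) < n := by exact_mod_cast hn
    have h1 : Real.log ((n : ℝ) + 1) - Real.log n ≤ 1 / n := by
      rw [← Real.log_div (by positivity) (by positivity)]
      refine (Real.log_le_sub_one_of_pos (by positivity)).trans (le_of_eq ?_)
      field_simp
      ring
    have h2 : 1 / ((n : ℝ) + 1) ≤ Real.log ((n : ℝ) + 1) - Real.log n := by
      have := Real.log_le_sub_one_of_pos (show (0 : ℝ) < n / (n + 1) by positivity)
      rw [Real.log_div (by positivity) (by positivity)] at this
      have h3 : (n : ℝ) / (n + 1) - 1 = -(1 / (n + 1)) := by field_simp; ring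
      linarith
    rw [div_le_iff₀ (by positivity)] at h2
    rw [le_div_iff₀ h0] at h1
    rw [Nat.factorial_succ]
    push_cast
    rw [Real.log_mul (by positivity) (by positivity)]
    constructor <;> nlinarith [ih.1, ih.2]

lemma abs_log_factorial_floor_sub_le {z y : ℝ} (hz : 0 < z) (hy : 1 ≤ y) (hzy : z ≤ y) :
    |Real.log (⌊z⌋₊ ! : ℕ) - z * (Real.log z - 1)| ≤ 1 + Real.log y := by
  have hy0 := Real.log_nonneg hy
  rcases lt_or_ge z 1 with h | h
  · rw [Nat.floor_eq_zero.2 h]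
    have h1 := Real.log_nonpos hz.le h.le
    have h2 := Real.log_le_sub_one_of_pos (inv_pos.2 hz)
    rw [Real.log_inv] at h2
    have h3 : z * z⁻¹ = 1 := mul_inv_cancel₀ hz.ne'
    simp only [Nat.factorial_zero, Nat.cast_one, Real.log_one, zero_sub, abs_neg]
    rw [abs_le]
    constructor <;> nlinarith
  · have hn : 1 ≤ ⌊z⌋₊ := Nat.one_le_floor_iff _ |>.2 h
    obtain ⟨h1, h2⟩ := mul_log_sub_le_log_factorial hn
    have h3 := Nat.floor_le hz.le
    have h4 := Nat.lt_floor_add_one z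
    set n := ⌊z⌋₊
    have h0 : (1 : ℝ) ≤ n := by exact_mod_cast hn
    have h5 : n * (Real.log z - Real.log n) ≤ z - n := by
      rw [← Real.log_div (by positivity) (by positivity)]
      have := Real.log_le_sub_one_of_pos (show (0 : ℝ) < z / n by positivity)
      calc _ ≤ n * (z / n - 1) := by gcongr
        _ = z - n := by field_simp
    have h6 : z - n ≤ z * (Real.log z - Real.log n) := by
      have := Real.log_le_sub_one_of_pos (show (0 : ℝ) < n / z by positivity)
      rw [Real.log_div (by positivity) (by positivity)] at this
      have h7 : z * (n / z) = n := by field_simp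
      nlinarith
    have h8 := Real.log_nonneg h0
    have h9 := Real.log_nonneg h
    have h10 : Real.log n ≤ Real.log y := Real.log_le_log (by positivity) (by linarith)
    have h11 : Real.log z ≤ Real.log y := Real.log_le_log (by positivity) (by linarith)
    rw [abs_le]
    constructor <;> nlinarith

lemma log_factorial_div_eq_sum (m d : ℕ) :
    Real.log ((m / d) ! : ℕ) = ∑ n ∈ Finset.Ioc 0 m, Λ n * ((m / n / d : ℕ) : ℝ) := by
  have h : ∀ N : ℕ, Real.log (N ! : ℕ) = ∑ n ∈ Finset.Ioc 0 N, Λ n * ((N / n : ℕ) : ℝ) := by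
    intro N
    rw [← sum_Ioc_mul_zeta_eq_sum, vonMangoldt_mul_zeta]
    induction N with
    | zero => simp
    | succ N ih =>
      rw [Finset.sum_Ioc_succ_top (by omega), ← ih, Nat.factorial_succ]
      push_cast
      rw [Real.log_mul (by positivity) (by positivity), log_apply]
      push_cast
      ring
  rw [h]
  refine (Finset.sum_subset_zero_on_sdiff (Finset.Ioc_subset_Ioc_right (Nat.div_le_self m d))
    ?_ ?_)
  · intro n hn
    simp only [Finset.mem_sdiff, Finset.mem_Ioc, not_and, not_le] at hn
    rw [Nat.div_div_eq_div_mul, mul_comm n, ← Nat.div_div_eq_div_mul,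
      Nat.div_eq_of_lt (hn.2 hn.1.1)]
    simp
  · intro n _
    rw [Nat.div_div_eq_div_mul, Nat.div_div_eq_div_mul, mul_comm d]

lemma psi_div_eq_sum {x : ℝ} {k : ℕ} (hk : 0 < k) :
    ψ (x / k) = ∑ n ∈ Finset.Ioc 0 ⌊x⌋₊, Λ n * (if k ≤ ⌊x⌋₊ / n then 1 else 0) := by
  rw [psi, Nat.floor_div_natCast]
  simp only [mul_ite, mul_one, mul_zero]
  rw [← Finset.sum_filter]
  refine Finset.sum_congr ?_ fun _ _ => rfl
  ext n
  simp only [Finset.mem_Ioc, Finset.mem_filter]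
  constructor
  · rintro ⟨h1, h2⟩
    refine ⟨⟨h1, h2.trans (Nat.div_le_self _ _)⟩, ?_⟩
    rw [Nat.le_div_iff_mul_le hk] at h2
    rwa [Nat.le_div_iff_mul_le h1, mul_comm]
  · rintro ⟨⟨h1, _⟩, h2⟩
    refine ⟨h1, ?_⟩
    rw [Nat.le_div_iff_mul_le h1] at h2
    rwa [Nat.le_div_iff_mul_le hk, mul_comm]

/-- The integer combination `∑ a_d ⌊u / d⌋` attached to a list of pairs `(d, a_d)`. -/
def floorSum (a : List (ℕ × ℤ)) (u : ℕ) : ℤ := (a.map fun p => p.2 * ((u / p.1 : ℕ) : ℤ)).sum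

/-- The step function `∑_{k ≤ u} t_k` attached to a list of pairs `(k, t_k)`. -/
def stepSum (t : List (ℕ × ℤ)) (u : ℕ) : ℤ := (t.map fun p => if p.1 ≤ u then p.2 else 0).sum

/-- The sum of the absolute values of the coefficients. -/
def weight (t : List (ℕ × ℤ)) : ℤ := (t.map fun p => |p.2|).sum

/-- The sum `∑ a_d / d`. -/
def recipSum (a : List (ℕ × ℤ)) : ℚ := (a.map fun p => (p.2 : ℚ) / p.1).sum

/-- The sum `∑ a_d log d / d`. -/
noncomputable def logSum (a : List (ℕ × ℤ)) : ℝ :=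
  (a.map fun p => (p.2 : ℝ) / p.1 * Real.log p.1).sum

/-- The sum `∑ t_k c_k / k`, where `c_k` is `α` or `β` according to the sign of `t_k`. -/
def signedSum (α β : ℚ) (t : List (ℕ × ℤ)) : ℚ :=
  (t.map fun p => (p.2 : ℚ) / p.1 * if 0 ≤ p.2 then α else β).sum

lemma sum_mul_log_factorial (a : List (ℕ × ℤ)) (m : ℕ) :
    (a.map fun p => (p.2 : ℝ) * Real.log ((m / p.1) ! : ℕ)).sum =
      ∑ n ∈ Finset.Ioc 0 m, Λ n * (floorSum a (m / n) : ℝ) := by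
  induction a with
  | nil => simp [floorSum]
  | cons p a ih =>
    simp only [List.map_cons, List.sum_cons, ih, floorSum, log_factorial_div_eq_sum m p.1,
      Finset.mul_sum, ← Finset.sum_add_distrib]
    refine Finset.sum_congr rfl fun n _ => ?_
    push_cast [-Int.natCast_ediv]
    ring

lemma sum_mul_psi (t : List (ℕ × ℤ)) (ht : ∀ p ∈ t, 0 < p.1) (x : ℝ) :
    (t.map fun p => (p.2 : ℝ) * ψ (x / p.1)).sum =
      ∑ n ∈ Finset.Ioc 0 ⌊x⌋₊, Λ n * (stepSum t (⌊x⌋₊ / n) : ℝ) := by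
  induction t with
  | nil => simp [stepSum]
  | cons p t ih =>
    simp only [List.map_cons, List.sum_cons, stepSum] at ih ⊢
    rw [ih fun q hq => ht q (List.mem_cons_of_mem _ hq), psi_div_eq_sum (ht p List.mem_cons_self),
      Finset.mul_sum, ← Finset.sum_add_distrib]
    refine Finset.sum_congr rfl fun n _ => ?_
    push_cast
    split_ifs <;> simp [mul_add, mul_comm]

lemma abs_sum_mul_log_factorial_add_le (a : List (ℕ × ℤ)) (ha : ∀ p ∈ a, 0 < p.1)
    (h0 : recipSum a = 0) {x : ℝ} (hx : 1 ≤ x) :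
    |(a.map fun p => (p.2 : ℝ) * Real.log ((⌊x⌋₊ / p.1) ! : ℕ)).sum + logSum a * x| ≤
      weight a * (1 + Real.log x) := by
  suffices h : |(a.map fun p => (p.2 : ℝ) * Real.log ((⌊x⌋₊ / p.1) ! : ℕ)).sum + logSum a * x -
      recipSum a * (x * (Real.log x - 1))| ≤ weight a * (1 + Real.log x) by
    simpa [h0] using h
  clear h0
  induction a with
  | nil => simp [logSum, recipSum, weight]
  | cons p a ih =>
    have ih' := ih fun q hq => ha q (List.mem_cons_of_mem _ hq)
    have hp : (1 : ℝ) ≤ p.1 := by exact_mod_cast ha p List.mem_cons_self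
    have h := abs_log_factorial_floor_sub_le (z := x / p.1) (by positivity) hx
      (div_le_self (by linarith) hp)
    rw [Nat.floor_div_natCast, Real.log_div (by positivity) (by positivity)] at h
    simp only [logSum, recipSum, weight, List.map_cons, List.sum_cons] at ih' ⊢
    have h2 := mul_le_mul_of_nonneg_left h (abs_nonneg (p.2 : ℝ))
    rw [← abs_mul] at h2
    push_cast at ih' ⊢
    rw [add_mul (|(p.2 : ℝ)|)]
    refine le_trans (le_of_eq ?_) ((abs_add_le _ _).trans (add_le_add h2 ih'))
    congr 1
    field_simp
    ring

/-- Chebyshev-type bounds for `ψ` with a logarithmic error term. -/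
def PsiBound (α β C : ℚ) : Prop :=
  0 ≤ α ∧ β ≤ C ∧ ∀ x : ℝ, 1 ≤ x →
    β * x - C * (1 + Real.log x) ≤ ψ x ∧ ψ x ≤ α * x + C * (1 + Real.log x)

lemma PsiBound.sum_mul_psi_le {α β C : ℚ} (h : PsiBound α β C) (hC : 0 ≤ C)
    (t : List (ℕ × ℤ)) (ht : ∀ p ∈ t, 0 < p.1) {x : ℝ} (hx : 1 ≤ x) :
    (t.map fun p => (p.2 : ℝ) * ψ (x / p.1)).sum ≤
      signedSum α β t * x + weight t * C * (1 + Real.log x) := by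
  obtain ⟨hα, hβ, h⟩ := h
  have hC' : (0 : ℝ) ≤ C := by exact_mod_cast hC
  have hα' : (0 : ℝ) ≤ α := by exact_mod_cast hα
  have hβ' : (β : ℝ) ≤ C := by exact_mod_cast hβ
  have hl := Real.log_nonneg hx
  induction t with
  | nil => simp [signedSum, weight]
  | cons p t ih =>
    have ih' := ih fun q hq => ht q (List.mem_cons_of_mem _ hq)
    have hp : (1 : ℝ) ≤ p.1 := by exact_mod_cast ht p List.mem_cons_self
    simp only [signedSum, weight, List.map_cons, List.sum_cons] at ih' ⊢
    push_cast at ih' ⊢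
    have hb : β * (x / p.1) - C * (1 + Real.log x) ≤ ψ (x / p.1) ∧
        ψ (x / p.1) ≤ α * (x / p.1) + C * (1 + Real.log x) := by
      rcases lt_or_ge (x / p.1) 1 with h1 | h1
      · rw [psi_eq_zero_of_lt_two (by linarith)]
        have h2 : 0 ≤ x / p.1 := by positivity
        refine ⟨?_, by positivity⟩
        have h3 : (β : ℝ) * (x / p.1) ≤ C * 1 :=
          (mul_le_mul_of_nonneg_right hβ' h2).trans (mul_le_mul_of_nonneg_left h1.le hC')
        nlinarith
      · have h2 : Real.log (x / p.1) ≤ Real.log x :=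
          Real.log_le_log (by linarith) (div_le_self (by linarith) hp)
        have h3 := mul_le_mul_of_nonneg_left h2 hC'
        obtain ⟨h4, h5⟩ := h _ h1
        constructor <;> linarith
    have h2 : (p.2 : ℝ) * ψ (x / p.1) ≤
        p.2 / p.1 * ((if 0 ≤ p.2 then α else β : ℚ) : ℝ) * x +
          |(p.2 : ℝ)| * C * (1 + Real.log x) := by
      split_ifs with hs
      · have hs' : (0 : ℝ) ≤ p.2 := by exact_mod_cast hs
        rw [abs_of_nonneg hs']
        refine (mul_le_mul_of_nonneg_left hb.2 hs').trans (le_of_eq ?_)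
        ring
      · have hs' : (p.2 : ℝ) ≤ 0 := by exact_mod_cast (not_le.1 hs).le
        rw [abs_of_nonpos hs']
        refine (mul_le_mul_of_nonpos_left hb.1 hs').trans (le_of_eq ?_)
        ring
    linarith

lemma PsiBound.mono {α β C α' β' C' : ℚ} (h : PsiBound α β C) (hα : α ≤ α') (hβ : β' ≤ β)
    (hC : C ≤ C') : PsiBound α' β' C' := by
  obtain ⟨h1, h2, h⟩ := h
  refine ⟨h1.trans hα, hβ.trans (h2.trans hC), fun x hx => ?_⟩
  obtain ⟨h3, h4⟩ := h x hx
  have hl : (0 : ℝ) ≤ 1 + Real.log x := by linarith [Real.log_nonneg hx]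
  have hx0 : (0 : ℝ) ≤ x := by linarith
  have h5 : (C : ℝ) * (1 + Real.log x) ≤ C' * (1 + Real.log x) :=
    mul_le_mul_of_nonneg_right (by exact_mod_cast hC) hl
  have h6 : (α : ℝ) * x ≤ α' * x := mul_le_mul_of_nonneg_right (by exact_mod_cast hα) hx0
  have h7 : (β' : ℝ) * x ≤ β * x := mul_le_mul_of_nonneg_right (by exact_mod_cast hβ) hx0
  constructor <;> linarith

lemma forall_of_periodic {a t : List (ℕ × ℤ)} {P s : ℕ} (hP : 0 < P)
    (hs : 2 * P ≤ s * s) (h0 : recipSum a = 0)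
    (ha : ∀ p ∈ a, p.1 ∣ P) (ht : ∀ p ∈ t, p.1 ≤ P) {R : ℤ → ℤ → Prop}
    (h : ∀ i < s, ∀ j < s, 1 ≤ s * i + j →
      R (floorSum a (s * i + j)) (stepSum t (s * i + j))) :
    ∀ u, 1 ≤ u → R (floorSum a u) (stepSum t u) := by
  have hper : ∀ u, floorSum a (u + P) = floorSum a u := by
    intro u
    suffices h1 : ((floorSum a (u + P) : ℤ) : ℚ) = floorSum a u + P * recipSum a by
      rw [h0, mul_zero, add_zero] at h1
      exact_mod_cast h1
    clear h0 h
    induction a with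
    | nil => simp [floorSum, recipSum]
    | cons p a ih =>
      have ih' := ih fun q hq => ha q (List.mem_cons_of_mem _ hq)
      obtain ⟨c, hc⟩ := ha p List.mem_cons_self
      have hp : 0 < p.1 := Nat.pos_of_dvd_of_pos (ha p List.mem_cons_self) hP
      simp only [floorSum, recipSum, List.map_cons, List.sum_cons] at ih' ⊢
      push_cast [-Int.natCast_ediv] at ih' ⊢
      rw [ih', show (u + P) / p.1 = u / p.1 + c by
        rw [hc, Nat.add_mul_div_left _ _ hp]]
      have : (P : ℚ) = p.1 * c := by exact_mod_cast hc
      have hp' : (p.1 : ℚ) ≠ 0 := by positivity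
      rw [mul_add]
      push_cast [-Int.natCast_ediv]
      rw [show (P : ℚ) * (p.2 / p.1) = p.2 * c by rw [this]; field_simp]
      ring
  have hconst : ∀ u, P ≤ u → stepSum t (u + P) = stepSum t u := by
    intro u hu
    unfold stepSum
    congr 1
    refine List.map_congr_left fun p hp => ?_
    rw [if_pos ((ht p hp).trans (by omega)), if_pos ((ht p hp).trans hu)]
  intro u
  induction u using Nat.strong_induction_on with
  | _ u ih =>
    intro hu
    rcases lt_or_ge u (2 * P) with h1 | h1
    · have h2 := Nat.div_add_mod u s
      have hs0 : 0 < s := Nat.pos_of_ne_zero (by rintro rfl; omega)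
      have := h (u / s) (Nat.div_lt_of_lt_mul (h1.trans_le hs)) (u % s) (Nat.mod_lt _ hs0)
      rw [h2] at this
      exact this hu
    · have := ih (u - P) (by omega) (by omega)
      rwa [← hper, ← hconst _ (by omega), Nat.sub_add_cancel (by omega)] at this

/-- One step of Chebyshev's method with data `a`, `tU`, `tL`. -/
lemma PsiBound.step {α β C : ℚ} (h : PsiBound α β C) (hC : 0 ≤ C) {a tU tL : List (ℕ × ℤ)}
    {α' β' C' : ℚ} (ha : ∀ p ∈ a, 0 < p.1) (h0 : recipSum a = 0)
    (htU : ∀ p ∈ tU, 0 < p.1) (htL : ∀ p ∈ tL, 0 < p.1)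
    (hU : ∀ u, 1 ≤ u → 1 - stepSum tU u ≤ floorSum a u)
    (hL : ∀ u, 1 ≤ u → floorSum a u ≤ 1 + stepSum tL u)
    (hα : -logSum a + signedSum α β tU ≤ α') (hβ : β' ≤ -logSum a - signedSum α β tL)
    (hα0 : 0 ≤ α') (hβC : β' ≤ C')
    (hCU : weight a + weight tU * C ≤ C') (hCL : weight a + weight tL * C ≤ C') :
    PsiBound α' β' C' := by
  refine ⟨hα0, hβC, fun x hx => ?_⟩
  have hx0 : (0 : ℝ) ≤ x := by linarith
  have hl : (0 : ℝ) ≤ 1 + Real.log x := by linarith [Real.log_nonneg hx]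
  have hA := abs_le.1 (abs_sum_mul_log_factorial_add_le a ha h0 hx)
  rw [sum_mul_log_factorial] at hA
  have hTU := h.sum_mul_psi_le hC tU htU hx
  have hTL := h.sum_mul_psi_le hC tL htL hx
  rw [sum_mul_psi _ htU] at hTU
  rw [sum_mul_psi _ htL] at hTL
  have hψ : ψ x = ∑ n ∈ Finset.Ioc 0 ⌊x⌋₊, Λ n := rfl
  have hdiv : ∀ n ∈ Finset.Ioc 0 ⌊x⌋₊, 1 ≤ ⌊x⌋₊ / n := fun n hn => by
    rw [Finset.mem_Ioc] at hn
    exact Nat.div_pos hn.2 hn.1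
  have hCU' : ((weight a : ℤ) : ℝ) + weight tU * C ≤ C' := by exact_mod_cast hCU
  have hCL' : ((weight a : ℤ) : ℝ) + weight tL * C ≤ C' := by exact_mod_cast hCL
  have e1 := mul_le_mul_of_nonneg_right hCU' hl
  have e2 := mul_le_mul_of_nonneg_right hCL' hl
  have e3 := mul_le_mul_of_nonneg_right hα hx0
  have e4 := mul_le_mul_of_nonneg_right hβ hx0
  constructor
  · have : (∑ n ∈ Finset.Ioc 0 ⌊x⌋₊, Λ n * (floorSum a (⌊x⌋₊ / n) : ℝ)) -
        ∑ n ∈ Finset.Ioc 0 ⌊x⌋₊, Λ n * (stepSum tL (⌊x⌋₊ / n) : ℝ) ≤ ψ x := by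
      rw [hψ, ← Finset.sum_sub_distrib]
      refine Finset.sum_le_sum fun n hn => ?_
      have h1 : (floorSum a (⌊x⌋₊ / n) : ℝ) ≤ 1 + stepSum tL (⌊x⌋₊ / n) := by
        exact_mod_cast hL _ (hdiv n hn)
      have h2 := mul_le_mul_of_nonneg_left h1 (vonMangoldt_nonneg (n := n))
      linarith
    linarith [hA.1]
  · have : ψ x ≤ (∑ n ∈ Finset.Ioc 0 ⌊x⌋₊, Λ n * (floorSum a (⌊x⌋₊ / n) : ℝ)) +
        ∑ n ∈ Finset.Ioc 0 ⌊x⌋₊, Λ n * (stepSum tU (⌊x⌋₊ / n) : ℝ) := by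
      rw [hψ, ← Finset.sum_add_distrib]
      refine Finset.sum_le_sum fun n hn => ?_
      have h1 : 1 - (stepSum tU (⌊x⌋₊ / n) : ℝ) ≤ floorSum a (⌊x⌋₊ / n) := by
        exact_mod_cast hU _ (hdiv n hn)
      have h2 := mul_le_mul_of_nonneg_left h1 (vonMangoldt_nonneg (n := n))
      linarith
    linarith [hA.2]

lemma log_seven_bounds : 1.945910 < Real.log 7 ∧ Real.log 7 < 1.945911 := by
  have h : 4 * Real.log 7 = 5 * Real.log 2 + Real.log 3 + 2 * Real.log 5 +
      Real.log (2401 / 2400) := by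
    rw [show (2401 / 2400 : ℝ) = 7 ^ 4 / (2 ^ 5 * 3 * 5 ^ 2) by norm_num,
      Real.log_div (by norm_num) (by norm_num), Real.log_mul (by norm_num) (by norm_num),
      Real.log_mul (by norm_num) (by norm_num)]
    simp only [Real.log_pow]
    push_cast
    ring
  have h1 := Real.log_le_sub_one_of_pos (show (0 : ℝ) < 2401 / 2400 by norm_num)
  have h2 := Real.one_sub_inv_le_log_of_pos (show (0 : ℝ) < 2401 / 2400 by norm_num)
  norm_num at h1 h2
  have := Real.log_two_gt_d9
  have := Real.log_two_lt_d9
  have := Real.log_three_gt_d9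
  have := Real.log_three_lt_d9
  have := Real.log_five_gt_d9
  have := Real.log_five_lt_d9
  constructor <;> linarith

lemma log_eleven_bounds : 2.397895 < Real.log 11 ∧ Real.log 11 < 2.397897 := by
  have h : 2 * Real.log 11 = 3 * Real.log 2 + 2 * Real.log 5 + 2 * Real.log 7 -
      4 * Real.log 3 + Real.log (9801 / 9800) := by
    rw [show (9801 / 9800 : ℝ) = (3 ^ 4 * 11 ^ 2) / (2 ^ 3 * 5 ^ 2 * 7 ^ 2) by norm_num,
      Real.log_div (by norm_num) (by norm_num), Real.log_mul (by norm_num) (by norm_num),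
      Real.log_mul (by norm_num) (by norm_num), Real.log_mul (by norm_num) (by norm_num)]
    simp only [Real.log_pow]
    push_cast
    ring
  have h1 := Real.log_le_sub_one_of_pos (show (0 : ℝ) < 9801 / 9800 by norm_num)
  have h2 := Real.one_sub_inv_le_log_of_pos (show (0 : ℝ) < 9801 / 9800 by norm_num)
  norm_num at h1 h2
  have := log_seven_bounds
  have := Real.log_two_gt_d9
  have := Real.log_two_lt_d9
  have := Real.log_three_gt_d9
  have := Real.log_three_lt_d9
  have := Real.log_five_gt_d9
  have := Real.log_five_lt_d9
  constructor <;> linarith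

/-- Chebyshev's coefficients, supported on divisors of `30`. -/
def coeff30 : List (ℕ × ℤ) := [(1, 1), (2, -1), (3, -1), (5, -1), (30, 1)]

/-- Coefficients supported on divisors of `2310`. -/
def coeff2310 : List (ℕ × ℤ) := [(1, 1), (2, -1), (3, -1), (5, -1), (6, 1), (7, -1), (10, 1),
  (11, -1), (14, 1), (30, -1), (42, -1), (70, -1), (2310, 1)]

/-- Correction terms used for upper bounds. -/
def upper2310 : List (ℕ × ℤ) := [(13, -1), (15, 1), (17, -1), (22, 1), (23, -1), (35, 1), (37,
  -1), (45, 1), (47, -1), (66, 1), (99, 1)]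

/-- Correction terms used for lower bounds. -/
def lower2310 : List (ℕ × ℤ) := [(13, 1), (15, -1), (17, 1), (19, 1), (21, -1), (29, 1), (33,
  -1), (41, 1), (44, -1), (53, 1), (63, -1), (73, 1), (84, -1), (99, 1)]

lemma logSum_coeff30_bounds : -0.921294 < logSum coeff30 ∧ logSum coeff30 < -0.921291 := by
  have h30 : Real.log 30 = Real.log 2 + Real.log 3 + Real.log 5 := by
    rw [show (30 : ℝ) = 2 * 3 * 5 by norm_num]
    iterate 2 rw [Real.log_mul (by norm_num) (by norm_num)]
  simp only [logSum, coeff30, List.map_cons, List.map_nil, List.sum_cons, List.sum_nil]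
  push_cast
  rw [h30, Real.log_one]
  have := Real.log_two_gt_d9
  have := Real.log_two_lt_d9
  have := Real.log_three_gt_d9
  have := Real.log_three_lt_d9
  have := Real.log_five_gt_d9
  have := Real.log_five_lt_d9
  constructor <;> linarith

lemma logSum_coeff2310_bounds : -1.072961 < logSum coeff2310 ∧ logSum coeff2310 < -1.072958 := by
  have h6 : Real.log 6 = Real.log 2 + Real.log 3 := by
    rw [show (6 : ℝ) = 2 * 3 by norm_num]
    iterate 1 rw [Real.log_mul (by norm_num) (by norm_num)]
  have h10 : Real.log 10 = Real.log 2 + Real.log 5 := by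
    rw [show (10 : ℝ) = 2 * 5 by norm_num]
    iterate 1 rw [Real.log_mul (by norm_num) (by norm_num)]
  have h14 : Real.log 14 = Real.log 2 + Real.log 7 := by
    rw [show (14 : ℝ) = 2 * 7 by norm_num]
    iterate 1 rw [Real.log_mul (by norm_num) (by norm_num)]
  have h30 : Real.log 30 = Real.log 2 + Real.log 3 + Real.log 5 := by
    rw [show (30 : ℝ) = 2 * 3 * 5 by norm_num]
    iterate 2 rw [Real.log_mul (by norm_num) (by norm_num)]
  have h42 : Real.log 42 = Real.log 2 + Real.log 3 + Real.log 7 := by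
    rw [show (42 : ℝ) = 2 * 3 * 7 by norm_num]
    iterate 2 rw [Real.log_mul (by norm_num) (by norm_num)]
  have h70 : Real.log 70 = Real.log 2 + Real.log 5 + Real.log 7 := by
    rw [show (70 : ℝ) = 2 * 5 * 7 by norm_num]
    iterate 2 rw [Real.log_mul (by norm_num) (by norm_num)]
  have h2310 : Real.log 2310 = Real.log 2 + Real.log 3 + Real.log 5 + Real.log 7 + Real.log 11 := by
    rw [show (2310 : ℝ) = 2 * 3 * 5 * 7 * 11 by norm_num]
    iterate 4 rw [Real.log_mul (by norm_num) (by norm_num)]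
  simp only [logSum, coeff2310, List.map_cons, List.map_nil, List.sum_cons, List.sum_nil]
  push_cast
  rw [h6, h10, h14, h30, h42, h70, h2310, Real.log_one]
  have := log_seven_bounds
  have := log_eleven_bounds
  have := Real.log_two_gt_d9
  have := Real.log_two_lt_d9
  have := Real.log_three_gt_d9
  have := Real.log_three_lt_d9
  have := Real.log_five_gt_d9
  have := Real.log_five_lt_d9
  constructor <;> linarith

lemma PsiBound.step_thirty {α β C α' : ℚ} (h : PsiBound α β C) (hC : 0 ≤ C)
    (hα : 921294 / 1000000 + α / 6 ≤ α') : PsiBound α' (921289 / 1000000) (5 + C) := by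
  have h0 : recipSum coeff30 = 0 := by decide +kernel
  have hb := logSum_coeff30_bounds
  have hα' : (921294 / 1000000 : ℝ) + α / 6 ≤ α' := by
    have := (Rat.cast_le (K := ℝ)).2 hα
    push_cast at this
    exact this
  have hw : weight coeff30 = 5 := by decide +kernel
  have hw1 : weight [(6, 1)] = 1 := by decide +kernel
  have hw2 : weight [] = 0 := by decide +kernel
  have hα0 := h.1
  refine h.step hC (a := coeff30) (tU := [(6, 1)]) (tL := []) (by decide +kernel) h0
    (by decide +kernel) (by decide +kernel)
    (forall_of_periodic (P := 30) (s := 8) (R := fun e t => 1 - t ≤ e) (by norm_num) (by norm_num)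
      h0 (by decide +kernel) (by decide +kernel) (by decide +kernel))
    (forall_of_periodic (P := 30) (s := 8) (R := fun e t => e ≤ 1 + t) (by norm_num) (by norm_num)
      h0 (by decide +kernel) (by decide +kernel) (by decide +kernel))
    ?_ ?_ (by linarith) (by linarith) ?_ ?_
  · simp [signedSum]
    linarith
  · simp [signedSum]
    linarith
  · rw [hw, hw1]
    push_cast
    linarith
  · rw [hw, hw2]
    push_cast
    linarith

lemma recipSum_coeff2310 : recipSum coeff2310 = 0 := by decide +kernel

/-- The sum `∑ ⌊u / d⌋` over a list of `d`, in a form that the kernel evaluates quickly. -/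
def divSum : List ℕ → ℕ → ℕ
  | [], _ => 0
  | d :: l, u => Nat.add (Nat.div u d) (divSum l u)

/-- The number of entries `k ≤ u` of a list of positive integers, in a form that the kernel
evaluates quickly. -/
def countLe : List ℕ → ℕ → ℕ
  | [], _ => 0
  | k :: l, u => Nat.add (Nat.sub 1 (Nat.sub k u)) (countLe l u)

lemma divSum_nil (u : ℕ) : divSum [] u = 0 := rfl

lemma divSum_cons (d : ℕ) (l : List ℕ) (u : ℕ) : divSum (d :: l) u = u / d + divSum l u := rfl

lemma countLe_nil (u : ℕ) : countLe [] u = 0 := rfl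

lemma countLe_cons (k : ℕ) (l : List ℕ) (u : ℕ) :
    countLe (k :: l) u = (if k ≤ u then 1 else 0) + countLe l u := by
  change 1 - (k - u) + countLe l u = _
  split_ifs <;> omega

lemma floorSum_coeff2310 (u : ℕ) :
    floorSum coeff2310 u =
      divSum [1, 6, 10, 14, 2310] u - divSum [2, 3, 5, 7, 11, 30, 42, 70] u := by
  simp only [floorSum, coeff2310, divSum_cons, divSum_nil, List.map_cons, List.map_nil,
    List.sum_cons, List.sum_nil, Nat.cast_add, Nat.cast_zero]
  ring

lemma stepSum_upper2310 (u : ℕ) :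
    stepSum upper2310 u =
      countLe [15, 22, 35, 45, 66, 99] u - countLe [13, 17, 23, 37, 47] u := by
  have h (k : ℕ) : (if k ≤ u then (-1 : ℤ) else 0) = -(if k ≤ u then 1 else 0) := by
    split_ifs <;> rfl
  simp only [stepSum, upper2310, countLe_cons, countLe_nil, List.map_cons, List.map_nil,
    List.sum_cons, List.sum_nil, Nat.cast_add, Nat.cast_zero, Nat.cast_ite, Nat.cast_one, h]
  ring

lemma stepSum_lower2310 (u : ℕ) :
    stepSum lower2310 u =
      countLe [13, 17, 19, 29, 41, 53, 73, 99] u - countLe [15, 21, 33, 44, 63, 84] u := by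
  have h (k : ℕ) : (if k ≤ u then (-1 : ℤ) else 0) = -(if k ≤ u then 1 else 0) := by
    split_ifs <;> rfl
  simp only [stepSum, lower2310, countLe_cons, countLe_nil, List.map_cons, List.map_nil,
    List.sum_cons, List.sum_nil, Nat.cast_add, Nat.cast_zero, Nat.cast_ite, Nat.cast_one, h]
  ring

lemma one_sub_stepSum_upper2310_le (u : ℕ) (hu : 1 ≤ u) :
    1 - stepSum upper2310 u ≤ floorSum coeff2310 u := by
  refine forall_of_periodic (a := coeff2310) (t := upper2310) (P := 2310) (s := 68)
    (R := fun e t => 1 - t ≤ e) (by norm_num) (by norm_num) recipSum_coeff2310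
    (by decide +kernel) (by decide +kernel) (fun i hi j hj hij => ?_) u hu
  have h : ∀ i < 68, ∀ j < 68, 1 ≤ 68 * i + j → Nat.ble
      (Nat.add (Nat.add 1 (countLe [13, 17, 23, 37, 47] (68 * i + j)))
        (divSum [2, 3, 5, 7, 11, 30, 42, 70] (68 * i + j)))
      (Nat.add (countLe [15, 22, 35, 45, 66, 99] (68 * i + j))
        (divSum [1, 6, 10, 14, 2310] (68 * i + j))) = true := by
    decide +kernel
  have h' := Nat.le_of_ble_eq_true (h i hi j hj hij)
  simp only [Nat.add_eq] at h'
  rw [floorSum_coeff2310, stepSum_upper2310]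
  omega

lemma floorSum_coeff2310_le (u : ℕ) (hu : 1 ≤ u) :
    floorSum coeff2310 u ≤ 1 + stepSum lower2310 u := by
  refine forall_of_periodic (a := coeff2310) (t := lower2310) (P := 2310) (s := 68)
    (R := fun e t => e ≤ 1 + t) (by norm_num) (by norm_num) recipSum_coeff2310
    (by decide +kernel) (by decide +kernel) (fun i hi j hj hij => ?_) u hu
  have h : ∀ i < 68, ∀ j < 68, 1 ≤ 68 * i + j → Nat.ble
      (Nat.add (divSum [1, 6, 10, 14, 2310] (68 * i + j))
        (countLe [15, 21, 33, 44, 63, 84] (68 * i + j)))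
      (Nat.add (Nat.add 1 (countLe [13, 17, 19, 29, 41, 53, 73, 99] (68 * i + j)))
        (divSum [2, 3, 5, 7, 11, 30, 42, 70] (68 * i + j))) = true := by
    decide +kernel
  have h' := Nat.le_of_ble_eq_true (h i hi j hj hij)
  simp only [Nat.add_eq] at h'
  rw [floorSum_coeff2310, stepSum_lower2310]
  omega

lemma PsiBound.step_2310 {α β C α' β' : ℚ} (h : PsiBound α β C) (hC : 0 ≤ C)
    (hα : 1072961 / 1000000 + signedSum α β upper2310 ≤ α')
    (hβ : β' ≤ 1072958 / 1000000 - signedSum α β lower2310) (hα0 : 0 ≤ α')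
    (hβ1 : β' ≤ 1) : PsiBound α' β' (13 + 14 * C) := by
  have hb := logSum_coeff2310_bounds
  have hα' : (1072961 / 1000000 : ℝ) + signedSum α β upper2310 ≤ α' := by
    have := (Rat.cast_le (K := ℝ)).2 hα
    push_cast at this
    exact this
  have hβ' : (β' : ℝ) ≤ 1072958 / 1000000 - signedSum α β lower2310 := by
    have := (Rat.cast_le (K := ℝ)).2 hβ
    push_cast at this
    exact this
  have hw : weight coeff2310 = 13 := by decide +kernel
  have hw1 : weight upper2310 = 11 := by decide +kernel
  have hw2 : weight lower2310 = 14 := by decide +kernel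
  refine h.step hC (a := coeff2310) (tU := upper2310) (tL := lower2310) (by decide +kernel)
    recipSum_coeff2310 (by decide +kernel) (by decide +kernel)
    one_sub_stepSum_upper2310_le floorSum_coeff2310_le
    (by linarith) (by linarith) hα0 (by linarith) ?_ ?_
  · rw [hw, hw1]
    push_cast
    linarith
  · rw [hw, hw2]
    push_cast
    linarith

lemma psiBound_trivial : PsiBound 6 0 0 := by
  refine ⟨by norm_num, le_rfl, fun x hx => ?_⟩
  have h := psi_le_const_mul_self (show 0 ≤ x by linarith)
  have h4 : Real.log 4 = 2 * Real.log 2 := by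
    rw [show (4 : ℝ) = 2 ^ 2 by norm_num, Real.log_pow]
    norm_num
  have := Real.log_two_lt_d9
  refine ⟨by simpa using psi_nonneg x, h.trans ?_⟩
  push_cast
  nlinarith

lemma psiBound_sharp : PsiBound 1.05809 0.94909 71343 := by
  have h1 : PsiBound 1.9213 0.921289 5 :=
    (psiBound_trivial.step_thirty le_rfl (by norm_num)).mono le_rfl (by norm_num) (by norm_num)
  have h2 : PsiBound 1.24152 0.921289 10 :=
    (h1.step_thirty (by norm_num) (by norm_num)).mono le_rfl (by norm_num) (by norm_num)
  have h3 : PsiBound 1.12822 0.921289 15 :=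
    (h2.step_thirty (by norm_num) (by norm_num)).mono le_rfl (by norm_num) (by norm_num)
  have h4 : PsiBound 1.10934 0.921289 20 :=
    (h3.step_thirty (by norm_num) (by norm_num)).mono le_rfl (by norm_num) (by norm_num)
  have h5 : PsiBound 1.10619 0.921289 25 :=
    (h4.step_thirty (by norm_num) (by norm_num)).mono le_rfl (by norm_num) (by norm_num)
  have h6 : PsiBound 1.0715 0.93198 363 :=
    (h5.step_2310 (by norm_num) (α' := 1.0715) (β' := 0.93198) (by decide +kernel)
      (by decide +kernel) (by norm_num) (by norm_num)).mono le_rfl le_rfl (by norm_num)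
  have h7 : PsiBound 1.06254 0.94412 5095 :=
    (h6.step_2310 (by norm_num) (α' := 1.06254) (β' := 0.94412) (by decide +kernel)
      (by decide +kernel) (by norm_num) (by norm_num)).mono le_rfl le_rfl (by norm_num)
  exact (h7.step_2310 (by norm_num) (α' := 1.05809) (β' := 0.94909) (by decide +kernel)
      (by decide +kernel) (by norm_num) (by norm_num)).mono le_rfl le_rfl (by norm_num)

lemma log_le_of_ge {z : ℝ} (hz : 10000000000 ≤ z) :
    Real.log z ≤ z / 10000000000 + 22.03 := by
  have h1 := Real.log_le_sub_one_of_pos (show (0 : ℝ) < z / 10000000000 by positivity)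
  rw [Real.log_div (by positivity) (by norm_num),
    show (10000000000 : ℝ) = (2 * 5) ^ 10 by norm_num, Real.log_pow,
    Real.log_mul (by norm_num) (by norm_num)] at h1
  have := Real.log_two_lt_d9
  have := Real.log_five_lt_d9
  norm_num at h1
  linarith

lemma sqrt_mul_log_le {z : ℝ} (hz : 10000000000 ≤ z) :
    √z * Real.log z ≤ 0.000232 * z := by
  have hs : 100000 ≤ √z := Real.le_sqrt_of_sq_le (by linarith)
  have hz2 : √z * √z = z := Real.mul_self_sqrt (by linarith)
  have h1 := Real.log_le_sub_one_of_pos (show (0 : ℝ) < √z / 100000 by positivity)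
  have h2 : Real.log z = 2 * Real.log (√z) := by rw [Real.log_sqrt (by linarith)]; ring
  rw [Real.log_div (by positivity) (by norm_num),
    show (100000 : ℝ) = (2 * 5) ^ 5 by norm_num, Real.log_pow,
    Real.log_mul (by norm_num) (by norm_num)] at h1
  have := Real.log_two_lt_d9
  have := Real.log_five_lt_d9
  norm_num at h1
  have h3 : Real.log z ≤ 0.000232 * √z := by linarith
  nlinarith

/-- Every interval `(y, 1.118 y]` with `y ≥ 10 ^ 10` contains a prime number. -/
theorem exists_prime_mem_Ioc_of_large {y : ℝ} (hy : 10000000000 ≤ y) :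
    ∃ p : ℕ, p.Prime ∧ y < p ∧ (p : ℝ) ≤ 1.118 * y := by
  by_contra! hno
  have hθ : θ (1.118 * y) = θ y := by
    have hsub : Finset.Ioc 0 ⌊y⌋₊ ⊆ Finset.Ioc 0 ⌊1.118 * y⌋₊ :=
      Finset.Ioc_subset_Ioc_right (Nat.floor_le_floor (by linarith))
    rw [theta, theta]
    symm
    refine Finset.sum_subset (Finset.filter_subset_filter _ hsub) fun p hp hp' => ?_
    rw [Finset.mem_filter, Finset.mem_Ioc] at hp hp'
    refine absurd ?_ (hno p hp.2 ?_).not_ge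
    · exact (Nat.le_floor_iff (by linarith)).1 hp.1.2
    · rw [← Nat.floor_lt (by linarith)]
      by_contra! h
      exact hp' ⟨⟨hp.1.1, h⟩, hp.2⟩
  have h1 := (psiBound_sharp.2.2 (1.118 * y) (by linarith)).1
  have h2 := (psiBound_sharp.2.2 y (by linarith)).2
  have h3 := psi_sub_theta_le (show 1 ≤ 1.118 * y by linarith)
  have h4 := theta_le_psi y
  have h5 := sqrt_mul_log_le (show 10000000000 ≤ 1.118 * y by linarith)
  have h6 := log_le_of_ge (show 10000000000 ≤ 1.118 * y by linarith)
  have h7 := log_le_of_ge hy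
  push_cast at h1 h2
  norm_num at h1 h2
  linarith

end ChebyshevBounds

section PrimeChain

/-- Proth's primality criterion. -/
lemma prime_of_proth {n k a : ℕ} (hk : 0 < k) (hdvd : 2 ^ k ∣ n - 1) (hn : n < (2 ^ k + 1) ^ 2)
    (hn3 : 3 ≤ n) (h : a ^ ((n - 1) / 2) % n = n - 1) : n.Prime := by
  by_contra hcomp
  set q := n.minFac with hq
  have hqn : q ∣ n := Nat.minFac_dvd n
  have hqp : q.Prime := Nat.minFac_prime (by omega)
  have : Fact q.Prime := ⟨hqp⟩
  have hq2 : q ^ 2 ≤ n := Nat.minFac_sq_le_self (by omega) hcomp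
  obtain ⟨c, hc⟩ := hdvd
  obtain ⟨j, rfl⟩ : ∃ j, k = j + 1 := ⟨k - 1, by omega⟩
  have hhalf : (n - 1) / 2 = c * 2 ^ j := by
    rw [hc, pow_succ]
    exact Nat.div_eq_of_eq_mul_left two_pos (by ring)
  have hodd : ¬ 2 ∣ n := by
    have : 2 ∣ n - 1 := hc ▸ Dvd.dvd.mul_right (dvd_pow_self 2 (by omega)) c
    omega
  have hneg : ((a : ZMod q) ^ c) ^ 2 ^ j = -1 := by
    have h1 : a ^ ((n - 1) / 2) + 1 ≡ 0 [MOD n] := by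
      have h2 : a ^ ((n - 1) / 2) ≡ n - 1 [MOD n] := by
        rw [Nat.ModEq, h, Nat.mod_eq_of_lt (by omega)]
      refine (h2.add_right 1).trans ?_
      rw [Nat.sub_add_cancel (by omega)]
      simp [Nat.ModEq]
    have h3 := (ZMod.natCast_eq_natCast_iff _ _ q).2 (h1.of_dvd hqn)
    rw [hhalf] at h3
    push_cast at h3
    rw [← pow_mul]
    exact eq_neg_of_add_eq_zero_left h3
  have hq3 : q ≠ 2 := fun h2 => hodd (h2 ▸ hqn)
  have hne : (-1 : ZMod q) ≠ 1 := by
    have : Fact (2 < q) := ⟨lt_of_le_of_ne hqp.two_le hq3.symm⟩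
    exact ZMod.neg_one_ne_one
  have hord : orderOf ((a : ZMod q) ^ c) = 2 ^ (j + 1) :=
    orderOf_eq_prime_pow (by rwa [hneg]) (by rw [pow_succ, pow_mul, hneg]; ring)
  have hne0 : (a : ZMod q) ^ c ≠ 0 := by
    intro h0
    rw [h0, zero_pow (by positivity)] at hneg
    exact one_ne_zero (neg_eq_zero.1 hneg.symm)
  have hle := Nat.le_of_dvd (Nat.sub_pos_of_lt hqp.one_lt) (ZMod.orderOf_dvd_card_sub_one hne0)
  rw [hord] at hle
  have : 2 ^ (j + 1) + 1 ≤ q := by have := hqp.one_lt; omega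
  have := Nat.pow_le_pow_left this 2
  omega

/-- Modular exponentiation by repeated squaring, with `fuel` bounding the length of `e`. -/
def powModFuel : ℕ → ℕ → ℕ → ℕ → ℕ
  | 0, _, _, _ => 1
  | fuel + 1, b, e, n =>
    if e = 0 then 1 else (b ^ (e % 2) * powModFuel fuel (b * b % n) (e / 2) n) % n

lemma powModFuel_modEq {fuel b e n : ℕ} (h : e < 2 ^ fuel) :
    powModFuel fuel b e n ≡ b ^ e [MOD n] := by
  induction fuel generalizing b e with
  | zero =>
    obtain rfl : e = 0 := by simpa using h
    exact Nat.ModEq.refl _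
  | succ fuel ih =>
    rw [powModFuel]
    split_ifs with he
    · subst he
      exact Nat.ModEq.refl _
    · have hb : b ^ e = b ^ (e % 2) * (b * b) ^ (e / 2) := by
        rw [← pow_two, ← pow_mul, ← pow_add, Nat.mod_add_div]
      rw [hb]
      refine (Nat.mod_modEq _ _).trans (Nat.ModEq.mul_left _ ?_)
      exact (ih (by rw [pow_succ] at h; omega)).trans ((Nat.mod_modEq _ _).pow _)

/-- Primes of moderate size, in increasing order. -/
def moderatePrimes : List ℕ := [139, 151, 167, 181, 199, 211, 233, 257, 283, 313, 349, 389, 433,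
  479, 523, 577, 643, 709, 787, 877, 977, 1091, 1217, 1327, 1483, 1657, 1847, 2063, 2297, 2557,
  2857, 3191, 3559, 3967, 4423, 4943, 5521, 6163, 6883, 7691, 8597, 9601, 10733, 11987, 13399,
  14969, 16729, 18701, 20903, 23369, 26119, 29201, 32647, 36497]

/-- Triples `(p, k, a)` where `p` is prime by Proth's criterion with exponent `k` and base `a`. -/
def prothPrimes : List (ℕ × ℕ × ℕ) := [(40193, 8, 3), (43777, 8, 5), (46337, 8, 3), (51713, 9,
  3), (57601, 8, 7), (61441, 12, 11), (67073, 9, 3), (70657, 10, 5), (76801, 10, 11), (84481, 9,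
  7), (87553, 9, 5), (96769, 9, 11), (102913, 9, 5), (114689, 14, 3), (125441, 9, 3), (138241,
  10, 7), (153089, 9, 3), (170497, 9, 5), (188417, 13, 3), (202753, 11, 5), (220673, 9, 3),
  (242689, 10, 7), (270337, 13, 5), (301057, 11, 5), (331777, 12, 5), (366593, 11, 3), (394241,
  10, 3), (430081, 12, 13), (473089, 11, 13), (525313, 10, 5), (577537, 12, 5), (643073, 12, 3),
  (715777, 10, 5), (796673, 11, 3), (879617, 10, 3), (979969, 10, 37), (1093633, 12, 5),
  (1210369, 11, 7), (1345537, 11, 5), (1503233, 12, 3), (1669121, 11, 3), (1865729, 11, 3),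
  (2056193, 13, 3), (2297857, 12, 5), (2553857, 11, 3), (2836481, 11, 3), (3168257, 11, 3),
  (3526657, 12, 5), (3942401, 11, 3), (4366337, 13, 3), (4866049, 14, 7), (5431297, 13, 5),
  (6008833, 12, 5), (6684673, 17, 5), (7462913, 13, 3), (8318977, 12, 5), (9220097, 12, 3),
  (10223617, 18, 5), (11370497, 15, 3), (12685313, 12, 3), (14172161, 14, 3), (15831041, 12, 3),
  (17522689, 13, 11), (19529729, 17, 3), (21741569, 14, 3), (24199169, 14, 3), (27025409, 13,
  3), (30195713, 14, 3), (33710081, 13, 3), (37601281, 14, 19), (42016769, 13, 3), (46964737,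
  13, 5), (52461569, 15, 3), (58613761, 13, 7), (65462273, 13, 3), (73039873, 15, 5), (81592321,
  16, 7), (91176961, 14, 11), (101908481, 16, 3), (113836033, 16, 5), (127172609, 15, 3),
  (142163969, 14, 3), (158679041, 14, 3), (177340417, 17, 5), (198082561, 15, 7), (221331457,
  14, 5), (247431169, 15, 7), (276430849, 17, 11), (308150273, 17, 3), (344424449, 15, 3),
  (384368641, 16, 7), (429391873, 19, 5), (479395841, 16, 3), (535920641, 15, 3), (599031809,
  15, 3), (669614081, 15, 3), (748552193, 17, 3), (836370433, 17, 5), (933888001, 17, 11),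
  (1043955713, 15, 3), (1166934017, 17, 3), (1303904257, 19, 5), (1456930817, 16, 3),
  (1628569601, 17, 3), (1819410433, 17, 5), (2033975297, 18, 3), (2273640449, 16, 3),
  (2541617153, 17, 3), (2840395777, 16, 5), (3175088129, 22, 3), (3549429761, 20, 3),
  (3967418369, 17, 3), (4434296833, 17, 5), (4957536257, 17, 3), (5539102721, 19, 3),
  (6192234497, 17, 3), (6921781249, 17, 7), (7737180161, 18, 3), (8648654849, 23, 3),
  (9668263937, 17, 3), (10808721409, 22, 7)]

lemma prime_of_mem_moderatePrimes {p : ℕ} (hp : p ∈ moderatePrimes) : p.Prime := by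
  have h : ∀ p ∈ moderatePrimes, 2 ≤ p ∧ p < 200 * 200 ∧ ∀ d < 200, 2 ≤ d → d < p → p % d ≠ 0 := by
    decide +kernel
  obtain ⟨h2, h3, h4⟩ := h p hp
  by_contra hcomp
  have h5 := Nat.minFac_sq_le_self (by omega) hcomp
  have h6 := Nat.minFac_prime (show p ≠ 1 by omega)
  refine h4 p.minFac (by nlinarith) h6.two_le ?_ (Nat.mod_eq_zero_of_dvd (Nat.minFac_dvd p))
  exact (Nat.not_prime_iff_minFac_lt h2).1 hcomp

lemma prime_of_mem_prothPrimes {t : ℕ × ℕ × ℕ} (ht : t ∈ prothPrimes) : t.1.Prime := by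
  have h : ∀ t ∈ prothPrimes, 0 < t.2.1 ∧ (t.1 - 1) % 2 ^ t.2.1 = 0 ∧ t.1 < (2 ^ t.2.1 + 1) ^ 2 ∧
      3 ≤ t.1 ∧ (t.1 - 1) / 2 < 2 ^ 40 ∧
      powModFuel 40 t.2.2 ((t.1 - 1) / 2) t.1 = t.1 - 1 := by
    decide +kernel
  obtain ⟨h1, h2, h3, h4, h5, h6⟩ := h t ht
  refine prime_of_proth h1 (Nat.dvd_of_mod_eq_zero h2) h3 h4 ?_ (a := t.2.2)
  have h7 := powModFuel_modEq (b := t.2.2) (n := t.1) h5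
  rw [h6] at h7
  rw [← h7, Nat.mod_eq_of_lt (by omega)]

lemma exists_mem_of_isChain {n : ℕ} {l : List ℕ} {p : ℕ}
    (hl : List.IsChain (fun p q => 4 * q ^ 2 ≤ 5 * p ^ 2) (p :: l)) (hp : p ^ 2 < 4 * n)
    (hlast : ∃ q ∈ l, 4 * n ≤ q ^ 2) : ∃ q ∈ l, 4 * n ≤ q ^ 2 ∧ q ^ 2 ≤ 5 * n := by
  induction l generalizing p with
  | nil => simp at hlast
  | cons q l ih =>
    rw [List.isChain_cons_cons] at hl
    rcases le_or_gt (4 * n) (q ^ 2) with h | h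
    · exact ⟨q, List.mem_cons_self, h, by omega⟩
    · obtain ⟨r, hr, h1⟩ := hlast
      rcases List.mem_cons.1 hr with rfl | hr
      · omega
      · obtain ⟨s, hs, h2⟩ := ih hl.2 h ⟨r, hr, h1⟩
        exact ⟨s, List.mem_cons_of_mem _ hs, h2⟩

/-- For all `n ≥ 4033` there is a prime between `2 √n` and `√(5 n)`. -/
theorem exists_prime_sq_mem_Icc {n : ℕ} (hn : 4033 ≤ n) :
    ∃ p : ℕ, p.Prime ∧ 4 * n ≤ p ^ 2 ∧ p ^ 2 ≤ 5 * n := by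
  rcases le_or_gt (4 * n) (10000000000 ^ 2) with h | h
  · have hch : List.IsChain (fun p q => 4 * q ^ 2 ≤ 5 * p ^ 2)
        (127 :: (moderatePrimes ++ prothPrimes.map Prod.fst)) := by
      decide +kernel
    obtain ⟨q, hq, h1⟩ := exists_mem_of_isChain (n := n) hch (by omega)
      ⟨10808721409, by decide +kernel, by omega⟩
    refine ⟨q, ?_, h1⟩
    rcases List.mem_append.1 hq with hq | hq
    · exact prime_of_mem_moderatePrimes hq
    · obtain ⟨t, ht, rfl⟩ := List.mem_map.1 hq
      exact prime_of_mem_prothPrimes ht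
  · have hn' : (10000000000 : ℝ) ^ 2 ≤ 4 * n := by exact_mod_cast h.le
    have hs : √(4 * n) * √(4 * n) = 4 * (n : ℝ) := Real.mul_self_sqrt (by positivity)
    obtain ⟨p, hp, h1, h2⟩ := exists_prime_mem_Ioc_of_large (Real.le_sqrt_of_sq_le hn')
    have h0 := Real.sqrt_nonneg (4 * (n : ℝ))
    refine ⟨p, hp, ?_, ?_⟩
    · suffices (4 * n : ℝ) ≤ (p : ℝ) ^ 2 by exact_mod_cast this
      nlinarith
    · suffices (p : ℝ) ^ 2 ≤ 5 * n by exact_mod_cast this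
      nlinarith

/-- Half-open intervals of integers. -/
def sporadicRanges : List (ℕ × ℕ) :=
  [(3, 10), (13, 25), (31, 34), (43, 58), (91, 106), (133, 169), (241, 274), (553, 562),
    (3193, 3226)]

/-- Quadruples `(x, y, z, w)` such that the numbers `x ^ 2 + y ^ 2 + z ^ 2 + 2 w ^ 2` exhaust the
intervals in `sporadicRanges`. -/
def sporadicReps : List (ℕ × ℕ × ℕ × ℕ) := [(0, 1, 0, 1), (2, 0, 0, 0), (2, 0, 1, 0), (2, 0, 0,
  1), (2, 0, 1, 1), (2, 0, 2, 0), (0, 1, 0, 2), (2, 0, 3, 0), (1, 1, 2, 2), (2, 0, 3, 1), (2, 0,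
  2, 2), (0, 1, 4, 0), (0, 1, 3, 2), (0, 1, 4, 1), (2, 0, 4, 0), (2, 0, 3, 2), (2, 0, 4, 1), (2,
  0, 1, 3), (1, 1, 2, 3), (2, 0, 5, 1), (3, 1, 2, 3), (0, 1, 0, 4), (3, 0, 4, 3), (0, 1, 5, 3),
  (2, 0, 3, 4), (1, 1, 6, 2), (2, 0, 5, 3), (2, 0, 6, 2), (0, 1, 4, 4), (0, 1, 7, 0), (0, 1, 0,
  5), (2, 0, 4, 4), (2, 0, 7, 0), (2, 0, 0, 5), (2, 0, 7, 1), (1, 1, 6, 3), (3, 0, 4, 4), (3, 0,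
  8, 3), (2, 0, 4, 6), (2, 0, 9, 2), (1, 2, 9, 2), (3, 0, 6, 5), (3, 1, 6, 5), (0, 1, 8, 4), (0,
  1, 5, 6), (0, 1, 0, 7), (2, 0, 8, 4), (2, 0, 5, 6), (2, 0, 0, 7), (2, 0, 9, 3), (2, 0, 10, 0),
  (3, 0, 8, 4), (2, 0, 11, 2), (1, 1, 10, 4), (2, 0, 9, 5), (2, 0, 10, 4), (0, 1, 8, 6), (2, 0,
  6, 7), (1, 1, 3, 8), (2, 0, 8, 6), (2, 0, 3, 8), (3, 1, 10, 4), (2, 0, 11, 3), (3, 1, 6, 7),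
  (0, 1, 12, 0), (3, 0, 3, 8), (0, 1, 12, 1), (2, 0, 12, 0), (1, 1, 7, 7), (2, 0, 12, 1), (2, 0,
  7, 7), (1, 1, 10, 5), (0, 1, 12, 2), (2, 0, 10, 5), (3, 0, 12, 1), (2, 0, 12, 2), (2, 0, 11,
  4), (1, 2, 11, 4), (3, 0, 10, 5), (3, 1, 10, 5), (3, 0, 12, 2), (3, 0, 11, 4), (0, 1, 12, 3),
  (0, 1, 1, 9), (0, 1, 6, 8), (2, 0, 12, 3), (2, 0, 1, 9), (2, 0, 6, 8), (5, 0, 12, 6), (0, 1,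
  13, 6), (0, 1, 12, 7), (0, 1, 15, 3), (2, 0, 13, 6), (2, 0, 12, 7), (2, 0, 15, 3), (1, 1, 14,
  5), (7, 0, 0, 10), (2, 0, 14, 5), (3, 0, 12, 7), (0, 1, 3, 11), (2, 0, 11, 8), (1, 2, 11, 8),
  (2, 0, 3, 11), (3, 1, 14, 5), (0, 1, 16, 0), (0, 1, 15, 4), (0, 1, 16, 1), (2, 0, 16, 0), (2,
  0, 15, 4), (2, 0, 16, 1), (0, 1, 10, 9), (1, 1, 10, 9), (0, 1, 16, 2), (2, 0, 10, 9), (3, 0,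
  16, 1), (2, 0, 16, 2), (0, 1, 14, 6), (1, 1, 14, 6), (2, 0, 13, 7), (2, 0, 14, 6), (0, 1, 12,
  8), (3, 0, 16, 12), (2, 0, 10, 15), (1, 2, 10, 15), (3, 0, 23, 3), (0, 1, 22, 6), (1, 1, 22,
  6), (3, 0, 10, 15), (2, 0, 22, 6), (5, 0, 12, 14), (5, 0, 56, 4), (5, 0, 37, 30), (3, 0, 56,
  5), (3, 0, 55, 9), (3, 1, 55, 9), (9, 1, 54, 10), (5, 0, 46, 23), (5, 1, 46, 23), (0, 1, 0,
  40), (0, 1, 53, 14), (0, 1, 32, 33), (2, 0, 0, 40), (2, 0, 53, 14), (2, 0, 32, 33), (2, 0, 39,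
  29), (2, 0, 54, 12), (0, 1, 56, 6), (0, 1, 3, 40), (3, 0, 32, 33), (2, 0, 56, 6), (2, 0, 3,
  40), (1, 1, 30, 34), (2, 0, 13, 39), (2, 0, 30, 34), (0, 1, 52, 16), (0, 1, 25, 36), (0, 1,
  36, 31), (2, 0, 52, 16), (2, 0, 25, 36), (2, 0, 36, 31), (0, 1, 50, 19), (1, 1, 50, 19), (3,
  0, 52, 16)]

lemma exists_rep_of_mem_sporadicRanges {n : ℕ} {r : ℕ × ℕ} (hr : r ∈ sporadicRanges)
    (h1 : r.1 ≤ n) (h2 : n < r.2) :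
    ∃ x y z w p : ℕ, p.Prime ∧ n = x ^ 2 + y ^ 2 + z ^ 2 + 2 * w ^ 2 ∧ x + 2 * y = p := by
  have h : ∀ r ∈ sporadicRanges, ∀ i < r.2 - r.1, ∃ t ∈ sporadicReps,
      r.1 + i = t.1 ^ 2 + t.2.1 ^ 2 + t.2.2.1 ^ 2 + 2 * t.2.2.2 ^ 2 ∧
        t.1 + 2 * t.2.1 ∈ [2, 3, 5, 7, 11] := by
    decide +kernel
  obtain ⟨t, -, ht, hp⟩ := h r hr (n - r.1) (by omega)
  rw [Nat.add_sub_cancel' h1] at ht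
  refine ⟨_, _, _, _, _, ?_, ht, rfl⟩
  have hprime : ∀ p ∈ [2, 3, 5, 7, 11], p.Prime := by
    simp only [List.mem_cons, List.not_mem_nil, or_false, forall_eq_or_imp, forall_eq]
    norm_num
  exact hprime _ hp

lemma exists_rep_or_prime_of_lt {n : ℕ} (h0 : 0 < n) (hn : n < 4033) :
    (∃ r ∈ sporadicRanges, r.1 ≤ n ∧ n < r.2) ∨
      ∃ p : ℕ, p.Prime ∧ p ≠ 5 ∧ 4 * n ≤ p ^ 2 ∧ p ^ 2 ≤ 5 * n := by
  have h : ∀ p ∈ [2, 3, 7, 11, 13, 17, 19, 23, 29, 31, 37, 41, 43, 47, 53, 59, 61, 67, 71, 73, 79,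
    83, 89, 97, 101, 103, 107, 109, 113, 127], p.Prime ∧ p ≠ 5 := by
    simp only [List.mem_cons, List.not_mem_nil, or_false, forall_eq_or_imp, forall_eq]
    norm_num
  by_contra! hcon
  obtain ⟨h1, h2⟩ := hcon
  simp only [sporadicRanges, List.mem_cons, List.not_mem_nil, or_false, forall_eq_or_imp,
    forall_eq] at h1
  have a2 := h2 2 (h 2 (by simp)).1 (by norm_num)
  have a3 := h2 3 (h 3 (by simp)).1 (by norm_num)
  have a7 := h2 7 (h 7 (by simp)).1 (by norm_num)
  have a11 := h2 11 (h 11 (by simp)).1 (by norm_num)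
  have a13 := h2 13 (h 13 (by simp)).1 (by norm_num)
  have a17 := h2 17 (h 17 (by simp)).1 (by norm_num)
  have a19 := h2 19 (h 19 (by simp)).1 (by norm_num)
  have a23 := h2 23 (h 23 (by simp)).1 (by norm_num)
  have a29 := h2 29 (h 29 (by simp)).1 (by norm_num)
  have a31 := h2 31 (h 31 (by simp)).1 (by norm_num)
  have a37 := h2 37 (h 37 (by simp)).1 (by norm_num)
  have a41 := h2 41 (h 41 (by simp)).1 (by norm_num)
  have a43 := h2 43 (h 43 (by simp)).1 (by norm_num)
  have a47 := h2 47 (h 47 (by simp)).1 (by norm_num)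
  have a53 := h2 53 (h 53 (by simp)).1 (by norm_num)
  have a59 := h2 59 (h 59 (by simp)).1 (by norm_num)
  have a61 := h2 61 (h 61 (by simp)).1 (by norm_num)
  have a67 := h2 67 (h 67 (by simp)).1 (by norm_num)
  have a71 := h2 71 (h 71 (by simp)).1 (by norm_num)
  have a73 := h2 73 (h 73 (by simp)).1 (by norm_num)
  have a79 := h2 79 (h 79 (by simp)).1 (by norm_num)
  have a83 := h2 83 (h 83 (by simp)).1 (by norm_num)
  have a89 := h2 89 (h 89 (by simp)).1 (by norm_num)
  have a97 := h2 97 (h 97 (by simp)).1 (by norm_num)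
  have a101 := h2 101 (h 101 (by simp)).1 (by norm_num)
  have a103 := h2 103 (h 103 (by simp)).1 (by norm_num)
  have a107 := h2 107 (h 107 (by simp)).1 (by norm_num)
  have a109 := h2 109 (h 109 (by simp)).1 (by norm_num)
  have a113 := h2 113 (h 113 (by simp)).1 (by norm_num)
  have a127 := h2 127 (h 127 (by simp)).1 (by norm_num)
  omega

end PrimeChain

section TernaryForms

/-- The ternary quadratic form
`a x ^ 2 + b y ^ 2 + c z ^ 2 + 2 f y z + 2 g x z + 2 h x y`. -/
structure TernaryForm where
  a : ℤ
  b : ℤ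
  c : ℤ
  f : ℤ
  g : ℤ
  h : ℤ

namespace TernaryForm

/-- The value of a ternary form. -/
def eval (F : TernaryForm) (x y z : ℤ) : ℤ :=
  F.a * x ^ 2 + F.b * y ^ 2 + F.c * z ^ 2 + 2 * F.f * y * z + 2 * F.g * x * z + 2 * F.h * x * y

/-- The determinant of the Gram matrix. -/
def det (F : TernaryForm) : ℤ :=
  F.a * F.b * F.c + 2 * F.f * F.g * F.h - F.a * F.f ^ 2 - F.b * F.g ^ 2 - F.c * F.h ^ 2

/-- The leading `2 × 2` minor of the Gram matrix. -/
def minor (F : TernaryForm) : ℤ := F.a * F.b - F.h ^ 2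

/-- `F` is positive definite of determinant `D`, and it has the same values as `F₀`. -/
structure SameValues (F₀ : TernaryForm) (D : ℤ) (F : TernaryForm) : Prop where
  a_pos : 0 < F.a
  minor_pos : 0 < F.minor
  det_eq : F.det = D
  eval_mem : ∀ x y z, ∃ x' y' z', F.eval x y z = F₀.eval x' y' z'
  mem_eval : ∀ x y z, ∃ x' y' z', F₀.eval x y z = F.eval x' y' z'

variable {F₀ F : TernaryForm} {D : ℤ}

lemma SameValues.of_subst (hF : SameValues F₀ D F) {G : TernaryForm} (ha : 0 < G.a)
    (hm : 0 < G.minor) (hd : G.det = F.det)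
    (h1 : ∀ x y z, ∃ x' y' z', G.eval x y z = F.eval x' y' z')
    (h2 : ∀ x y z, ∃ x' y' z', F.eval x y z = G.eval x' y' z') : SameValues F₀ D G where
  a_pos := ha
  minor_pos := hm
  det_eq := hd.trans hF.det_eq
  eval_mem x y z := by
    obtain ⟨x', y', z', h⟩ := h1 x y z
    rw [h]
    exact hF.eval_mem x' y' z'
  mem_eval x y z := by
    obtain ⟨x', y', z', h⟩ := hF.mem_eval x y z
    rw [h]
    exact h2 x' y' z'

lemma SameValues.shift_xy (hF : SameValues F₀ D F) (k : ℤ) :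
    SameValues F₀ D ⟨F.a, F.b + 2 * F.h * k + F.a * k ^ 2, F.c, F.f + F.g * k, F.g,
      F.h + F.a * k⟩ := by
  refine hF.of_subst hF.a_pos ?_ ?_ (fun x y z => ⟨x + k * y, y, z, ?_⟩)
    (fun x y z => ⟨x - k * y, y, z, ?_⟩)
  · have := hF.minor_pos
    simp only [minor] at this ⊢
    linarith
  all_goals simp only [det, eval]; ring

lemma SameValues.shift_xz (hF : SameValues F₀ D F) (k : ℤ) :
    SameValues F₀ D ⟨F.a, F.b, F.c + 2 * F.g * k + F.a * k ^ 2, F.f + F.h * k,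
      F.g + F.a * k, F.h⟩ := by
  refine hF.of_subst hF.a_pos hF.minor_pos ?_ (fun x y z => ⟨x + k * z, y, z, ?_⟩)
    (fun x y z => ⟨x - k * z, y, z, ?_⟩)
  all_goals simp only [det, eval]; ring

lemma SameValues.shift_yz (hF : SameValues F₀ D F) (k : ℤ) :
    SameValues F₀ D ⟨F.a, F.b, F.c + 2 * F.f * k + F.b * k ^ 2, F.f + F.b * k,
      F.g + F.h * k, F.h⟩ := by
  refine hF.of_subst hF.a_pos hF.minor_pos ?_ (fun x y z => ⟨x, y + k * z, z, ?_⟩)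
    (fun x y z => ⟨x, y - k * z, z, ?_⟩)
  all_goals simp only [det, eval]; ring

lemma SameValues.swap_xy (hF : SameValues F₀ D F) :
    SameValues F₀ D ⟨F.b, F.a, F.c, F.g, F.f, F.h⟩ := by
  have ha := hF.a_pos
  have hm := hF.minor_pos
  simp only [minor] at hm
  refine hF.of_subst ?_ ?_ ?_ (fun x y z => ⟨y, x, z, ?_⟩) (fun x y z => ⟨y, x, z, ?_⟩)
  · exact pos_of_mul_pos_right (show 0 < F.a * F.b by nlinarith [sq_nonneg F.h]) ha.le
  · simp only [minor]
    linarith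
  all_goals simp only [det, eval]; ring

lemma minor_mul_sub (F : TernaryForm) :
    F.minor * (F.a * F.c - F.g ^ 2) - (F.a * F.f - F.g * F.h) ^ 2 = F.a * F.det := by
  simp only [minor, det]
  ring

lemma SameValues.swap_yz (hD : 0 < D) (hF : SameValues F₀ D F) :
    SameValues F₀ D ⟨F.a, F.c, F.b, F.f, F.h, F.g⟩ := by
  refine hF.of_subst hF.a_pos ?_ ?_ (fun x y z => ⟨x, z, y, ?_⟩) (fun x y z => ⟨x, z, y, ?_⟩)
  · have h := minor_mul_sub F
    rw [hF.det_eq] at h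
    have := mul_pos hF.a_pos hD
    exact pos_of_mul_pos_right
      (show 0 < F.minor * (F.a * F.c - F.g ^ 2) by
        nlinarith [sq_nonneg (F.a * F.f - F.g * F.h)]) hF.minor_pos.le
  all_goals simp only [det, eval]; ring

lemma exists_two_mul_abs_add_mul_le {a : ℤ} (ha : 0 < a) (h : ℤ) :
    ∃ k : ℤ, 2 * |h + a * k| ≤ a := by
  refine ⟨-((2 * h + a) / (2 * a)), ?_⟩
  have h1 := Int.mul_ediv_add_emod (2 * h + a) (2 * a)
  have h2 := Int.emod_nonneg (2 * h + a) (show 2 * a ≠ 0 by omega)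
  have h3 := Int.emod_lt_of_pos (2 * h + a) (show 0 < 2 * a by omega)
  have h4 : |2 * (h + a * -((2 * h + a) / (2 * a)))| ≤ a := by
    rw [abs_le]
    constructor <;> linarith
  rwa [abs_mul, abs_two] at h4

/-- Every positive definite ternary form has the same values as a reduced one. -/
theorem SameValues.exists_reduced (hD : 0 < D) (hF : SameValues F₀ D F) :
    ∃ G, SameValues F₀ D G ∧ 2 * |G.h| ≤ G.a ∧ 2 * |G.g| ≤ G.a ∧ G.a ≤ G.b ∧
      2 * |G.a * G.f - G.g * G.h| ≤ G.minor ∧ G.minor ≤ G.a * G.c - G.g ^ 2 := by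
  obtain ⟨G, hG, hmin⟩ : ∃ G, SameValues F₀ D G ∧ ∀ H, SameValues F₀ D H →
      G.a < H.a ∨ G.a = H.a ∧ G.minor ≤ H.minor := by
    let S : Set (ℕ ×ₗ ℕ) :=
      {p | ∃ G, SameValues F₀ D G ∧ p = toLex (G.a.toNat, G.minor.toNat)}
    have hne : S.Nonempty := ⟨_, F, hF, rfl⟩
    obtain ⟨G, hG, hp⟩ := WellFounded.min_mem (wellFounded_lt (α := ℕ ×ₗ ℕ)) S hne
    refine ⟨G, hG, fun H hH => ?_⟩
    have hle := WellFounded.min_le (wellFounded_lt (α := ℕ ×ₗ ℕ))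
      (show toLex (H.a.toNat, H.minor.toNat) ∈ S from ⟨H, hH, rfl⟩)
    rw [hp, Prod.Lex.le_iff] at hle
    have := hG.a_pos
    have := hH.a_pos
    have := hG.minor_pos
    have := hH.minor_pos
    simp only [ofLex_toLex] at hle
    omega
  obtain ⟨k, hk⟩ := exists_two_mul_abs_add_mul_le hG.minor_pos (G.a * G.f - G.g * G.h)
  have h1 := hG.shift_yz k
  obtain ⟨l, hl⟩ := exists_two_mul_abs_add_mul_le hG.a_pos G.h
  have h2 := h1.shift_xy l
  obtain ⟨m, hm⟩ := exists_two_mul_abs_add_mul_le hG.a_pos (G.g + G.h * k)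
  have h3 := h2.shift_xz m
  refine ⟨_, h3, hl, hm, ?_, ?_, ?_⟩
  · have := hmin _ h3.swap_xy
    simp only at this ⊢
    omega
  · simp only [minor] at hk ⊢
    refine le_of_eq_of_le (congrArg (fun t : ℤ => 2 * |t|) ?_) (hk.trans_eq ?_) <;> ring
  · have := hmin _ (h3.swap_yz hD)
    simp only [minor] at this ⊢
    rcases this with h | h
    · omega
    · linarith [h.2]

lemma reduced_bounds {G : TernaryForm} (hG : SameValues F₀ D G) (hh : 2 * |G.h| ≤ G.a)
    (hab : G.a ≤ G.b) (hB : 2 * |G.a * G.f - G.g * G.h| ≤ G.minor)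
    (hAC : G.minor ≤ G.a * G.c - G.g ^ 2) :
    3 * G.a ^ 2 ≤ 4 * G.minor ∧ 3 * G.minor ^ 2 ≤ 4 * (G.a * D) := by
  have ha := hG.a_pos
  have hA := hG.minor_pos
  have h1 := minor_mul_sub G
  rw [hG.det_eq] at h1
  have h2 : (2 * |G.h|) ^ 2 ≤ G.a ^ 2 := pow_le_pow_left₀ (by positivity) hh 2
  have h3 : (2 * |G.a * G.f - G.g * G.h|) ^ 2 ≤ G.minor ^ 2 :=
    pow_le_pow_left₀ (by positivity) hB 2
  rw [mul_pow, sq_abs] at h2 h3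
  refine ⟨?_, ?_⟩
  · have : G.minor = G.a * G.b - G.h ^ 2 := rfl
    nlinarith
  · nlinarith

lemma reduced_a_le_two {G : TernaryForm} (hD : D ≤ 10) (ha : 0 < G.a)
    (h : 3 * G.a ^ 2 ≤ 4 * G.minor ∧ 3 * G.minor ^ 2 ≤ 4 * (G.a * D)) : G.a ≤ 2 := by
  obtain ⟨h1, h2⟩ := h
  by_contra! h3
  have h4 : (3 * G.a ^ 2) ^ 2 ≤ (4 * G.minor) ^ 2 := pow_le_pow_left₀ (by positivity) h1 2
  have h5 : G.a * (27 * G.a ^ 3) ≤ G.a * 640 := by nlinarith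
  have h6 := le_of_mul_le_mul_left h5 ha
  have h7 : (3 : ℤ) ^ 3 ≤ G.a ^ 3 := pow_le_pow_left₀ (by norm_num) (by omega) 3
  omega

/-- A reduced form of determinant `D ≤ 10`, described by inequalities for its coefficients. -/
lemma exists_reduced_coeffs (hD : 0 < D) (hD' : D ≤ 10) (ha : 0 < F.a) (hA : 0 < F.minor)
    (hdet : F.det = D) : ∃ a b c f g h : ℤ,
      (∀ x y z, ∃ x' y' z', eval ⟨a, b, c, f, g, h⟩ x y z = F.eval x' y' z') ∧
      (∀ x y z, ∃ x' y' z', F.eval x y z = eval ⟨a, b, c, f, g, h⟩ x' y' z') ∧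
      0 < a ∧ a ≤ 2 ∧ a ≤ b ∧ 2 * |h| ≤ a ∧ 2 * |g| ≤ a ∧
      2 * |a * f - g * h| ≤ a * b - h ^ 2 ∧ a * b - h ^ 2 ≤ 5 ∧
      3 * (a * b - h ^ 2) ^ 2 ≤ 4 * (a * D) ∧ a * b - h ^ 2 ≤ a * c - g ^ 2 ∧
      (a * b - h ^ 2) * (a * c - g ^ 2) - (a * f - g * h) ^ 2 = a * D := by
  have hF : SameValues F D F := ⟨ha, hA, hdet, fun x y z => ⟨x, y, z, rfl⟩,
    fun x y z => ⟨x, y, z, rfl⟩⟩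
  obtain ⟨G, hG, hh, hg, hab, hB, hAC⟩ := hF.exists_reduced hD
  have hb := reduced_bounds hG hh hab hB hAC
  have ha2 := reduced_a_le_two hD' hG.a_pos hb
  have hdetG := minor_mul_sub G
  rw [hG.det_eq] at hdetG
  have hA5 : G.minor ≤ 5 := by nlinarith
  exact ⟨G.a, G.b, G.c, G.f, G.g, G.h, hG.eval_mem, hG.mem_eval, hG.a_pos, ha2, hab, hh, hg, hB,
    hA5, hb.2, hAC, hdetG⟩

/-- A positive definite form of determinant `10` with an odd value and no values congruent to
`10` modulo `25` has only values of `r ^ 2 + 2 * s ^ 2 + 5 * t ^ 2`. -/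
theorem exists_eval_eq_of_det_eq_ten (ha : 0 < F.a) (hA : 0 < F.minor) (hdet : F.det = 10)
    (hodd : ∃ x y z, F.eval x y z % 2 = 1)
    (hval : ∀ x y z, F.eval x y z % 25 ≠ 10) (x y z : ℤ) :
    ∃ r s t : ℤ, F.eval x y z = r ^ 2 + 2 * s ^ 2 + 5 * t ^ 2 := by
  obtain ⟨a, b, c, f, g, h, h1, h2, ha0, ha2, hab, hh, hg, hB, hA5, hA3, hAC, hd⟩ :=
    exists_reduced_coeffs (D := 10) (by norm_num) le_rfl ha hA hdet
  have hval' : ∀ x y z, eval ⟨a, b, c, f, g, h⟩ x y z % 25 ≠ 10 := fun x y z => by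
    obtain ⟨x', y', z', h⟩ := h1 x y z
    rw [h]
    exact hval x' y' z'
  have hodd' : ¬ (a % 2 = 0 ∧ b % 2 = 0 ∧ c % 2 = 0) := by
    rintro ⟨h3, h4, h5⟩
    obtain ⟨x, y, z, hx⟩ := hodd
    obtain ⟨x', y', z', h'⟩ := h2 x y z
    obtain ⟨a', rfl⟩ := Int.dvd_of_emod_eq_zero h3
    obtain ⟨b', rfl⟩ := Int.dvd_of_emod_eq_zero h4
    obtain ⟨c', rfl⟩ := Int.dvd_of_emod_eq_zero h5
    rw [h', show eval ⟨2 * a', 2 * b', 2 * c', f, g, h⟩ x' y' z' = 2 * (a' * x' ^ 2 + b' * y' ^ 2 +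
      c' * z' ^ 2 + f * y' * z' + g * x' * z' + h * x' * y') by simp only [eval]; ring] at hx
    omega
  obtain ⟨x, y, z, hxyz⟩ := h2 x y z
  rw [hxyz]
  clear hxyz hodd hval ha hA hdet h1 h2
  have e1 := hval' 0 0 1
  have e2 := hval' 2 1 0
  have e3 := hval' 1 2 0
  simp only [eval] at e1 e2 e3 ⊢
  clear hval'
  obtain rfl | rfl : a = 1 ∨ a = 2 := by omega
  · obtain rfl : h = 0 := by rw [← abs_eq_zero]; have := abs_nonneg h; omega
    obtain rfl : g = 0 := by rw [← abs_eq_zero]; have := abs_nonneg g; omega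
    obtain ⟨hf1, hf2⟩ := abs_le.1 (show |2 * f| ≤ b by
      rw [abs_mul, abs_two]
      simpa using hB)
    have hf3 : -2 ≤ f := by omega
    have hf4 : f ≤ 2 := by omega
    have hb3 : b ≤ 3 := by nlinarith
    clear hB hh hg hA3
    interval_cases b <;> interval_cases f <;> try omega
    all_goals
      obtain rfl | rfl : c = 10 ∨ c = 5 := by omega
    all_goals
      first
      | omega
      | exact ⟨x, y, z, by ring1⟩
  · exfalso
    obtain ⟨hh1, hh2⟩ := abs_le.1 (show |h| ≤ 1 by omega)
    obtain ⟨hg1, hg2⟩ := abs_le.1 (show |g| ≤ 1 by omega)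
    have hb3 : b ≤ 3 := by nlinarith
    obtain ⟨hB1, hB2⟩ := abs_le.1 (show |2 * (2 * f - g * h)| ≤ 2 * b - h ^ 2 by
      rwa [abs_mul, abs_two])
    clear hB hh hg hA3
    have hf1 : -1 ≤ f := by nlinarith
    have hf2 : f ≤ 1 := by nlinarith
    interval_cases h <;> interval_cases g <;> interval_cases b <;> interval_cases f <;>
      omega

/-- A positive definite form of determinant `5` with no values congruent to `5` modulo `25` has
only values of `r ^ 2 + 2 * s ^ 2 + 2 * s * t + 3 * t ^ 2`. -/
theorem exists_eval_eq_of_det_eq_five (ha : 0 < F.a) (hA : 0 < F.minor) (hdet : F.det = 5)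
    (hval : ∀ x y z, F.eval x y z % 25 ≠ 5) (x y z : ℤ) :
    ∃ r s t : ℤ, F.eval x y z = r ^ 2 + 2 * s ^ 2 + 2 * s * t + 3 * t ^ 2 := by
  obtain ⟨a, b, c, f, g, h, h1, h2, ha0, ha2, hab, hh, hg, hB, hA5, hA3, hAC, hd⟩ :=
    exists_reduced_coeffs (D := 5) (by norm_num) (by norm_num) ha hA hdet
  have e1 : eval ⟨a, b, c, f, g, h⟩ 0 0 1 % 25 ≠ 5 := by
    obtain ⟨x', y', z', h⟩ := h1 0 0 1
    rw [h]
    exact hval x' y' z'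
  obtain ⟨x, y, z, hxyz⟩ := h2 x y z
  rw [hxyz]
  clear hxyz hval ha hA hdet h1 h2
  simp only [eval] at e1 ⊢
  obtain rfl | rfl : a = 1 ∨ a = 2 := by omega
  · obtain rfl : h = 0 := by rw [← abs_eq_zero]; have := abs_nonneg h; omega
    obtain rfl : g = 0 := by rw [← abs_eq_zero]; have := abs_nonneg g; omega
    obtain ⟨hf1, hf2⟩ := abs_le.1 (show |2 * f| ≤ b by
      rw [abs_mul, abs_two]
      simpa using hB)
    have hb2 : b ≤ 2 := by nlinarith
    have hf3 : -1 ≤ f := by omega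
    have hf4 : f ≤ 1 := by omega
    clear hB hh hg hA3
    interval_cases b <;> interval_cases f <;> try omega
    all_goals
      obtain rfl : c = 3 := by omega
      first
      | exact ⟨x, y, z, by ring1⟩
      | exact ⟨x, y, -z, by ring⟩
  · exfalso
    obtain ⟨hh1, hh2⟩ := abs_le.1 (show |h| ≤ 1 by omega)
    obtain ⟨hg1, hg2⟩ := abs_le.1 (show |g| ≤ 1 by omega)
    have hb3 : b ≤ 3 := by nlinarith
    obtain ⟨hB1, hB2⟩ := abs_le.1 (show |2 * (2 * f - g * h)| ≤ 2 * b - h ^ 2 by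
      rwa [abs_mul, abs_two])
    clear hB hh hg hA3
    have hf1 : -1 ≤ f := by nlinarith
    have hf2 : f ≤ 1 := by nlinarith
    interval_cases h <;> interval_cases g <;> interval_cases b <;> interval_cases f <;>
      omega

end TernaryForm

end TernaryForms

section PrimeRestriction

open scoped NumberTheorySymbols

lemma jacobiSym_eq_of_dvd_add_five {M q : ℕ} (hM : Odd M) (hq : q % 4 = 3) (h : M ∣ q + 5) :
    J(M | q) = J(M | 5) := by
  have hqo : Odd q := Nat.odd_iff.2 (by omega)
  have h1 : J(q | M) = J(-5 | M) := by
    refine jacobiSym.mod_left' (Int.modEq_iff_dvd.2 ?_).symm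
    rw [sub_neg_eq_add]
    exact_mod_cast h
  have h2 : J((5 : ℕ) | M) = J(M | 5) := jacobiSym.quadratic_reciprocity_one_mod_four rfl hM
  rw [jacobiSym.neg _ hM] at h1
  rcases Nat.odd_mod_four_iff.1 (Nat.odd_iff.1 hM) with h4 | h4
  · rw [ZMod.χ₄_nat_one_mod_four h4, one_mul] at h1
    rw [jacobiSym.quadratic_reciprocity_one_mod_four h4 hqo, h1, ← h2]
    rfl
  · rw [ZMod.χ₄_nat_three_mod_four h4] at h1
    rw [jacobiSym.quadratic_reciprocity_three_mod_four h4 hq, h1, ← h2]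
    simp

/-- The arithmetic data from which the ternary forms of determinant `5` and `10` are built. -/
lemma exists_form_data {N κ : ℕ} (hN : Odd N)
    (hκ : κ = 1 ∧ (N % 5 = 2 ∨ N % 5 = 3) ∨ κ = 2 ∧ (N % 5 = 1 ∨ N % 5 = 4)) :
    ∃ q j β b : ℤ, 0 < q ∧ 0 < j ∧ q + 5 = 4 * κ * N * j ∧ q * b = 20 * κ * j * β ^ 2 + κ := by
  have hN0 : 0 < N := hN.pos
  have hcop : IsCoprime (-5 : ℤ) ((4 * κ * N : ℕ) : ℤ) := by
    rw [IsCoprime.neg_left_iff, show (5 : ℤ) = ((5 : ℕ) : ℤ) by rfl, Nat.isCoprime_iff_coprime,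
      Nat.Prime.coprime_iff_not_dvd Nat.prime_five, Nat.Prime.dvd_mul Nat.prime_five]
    omega
  obtain ⟨q, hq5, hqp, hq⟩ := Nat.forall_exists_prime_gt_and_zmodEq 5
    (show 4 * κ * N ≠ 0 by rcases hκ with ⟨rfl, -⟩ | ⟨rfl, -⟩ <;> omega) hcop
  have hdvd : 4 * κ * N ∣ q + 5 := by
    have := hq.symm.dvd
    rw [sub_neg_eq_add] at this
    exact_mod_cast this
  have : Fact q.Prime := ⟨hqp⟩
  have hNq : N ∣ q + 5 := (Dvd.intro_left _ rfl).trans hdvd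
  have hJ : J(-κ * N | q) = 1 := by
    rw [jacobiSym.mul_left]
    rcases hκ with ⟨rfl, h⟩ | ⟨rfl, h⟩
    · have hq4 : q % 4 = 3 := by
        have := (Dvd.intro _ (mul_assoc 4 1 N).symm).trans hdvd
        omega
      have hN5 : J(N | 5) = -1 := by
        rw [jacobiSym.mod_left]
        rcases h with h | h
        · rw [show (N : ℤ) % (5 : ℕ) = 2 by omega]
          norm_num
        · rw [show (N : ℤ) % (5 : ℕ) = 3 by omega]
          norm_num
      rw [jacobiSym_eq_of_dvd_add_five hN hq4 hNq, hN5, Nat.cast_one,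
        jacobiSym.at_neg_one (Nat.odd_iff.2 (by omega)), ZMod.χ₄_nat_three_mod_four hq4]
      rfl
    · have hq8 : q % 8 = 3 := by
        have := (Dvd.intro _ rfl).trans hdvd
        omega
      have hN5 : J(N | 5) = 1 := by
        rw [jacobiSym.mod_left]
        rcases h with h | h
        · rw [show (N : ℤ) % (5 : ℕ) = 1 by omega]
          norm_num
        · rw [show (N : ℤ) % (5 : ℕ) = 4 by omega]
          norm_num
      rw [jacobiSym_eq_of_dvd_add_five hN (by omega) hNq, hN5, Nat.cast_two,
        jacobiSym.at_neg_two (Nat.odd_iff.2 (by omega)), ZMod.χ₈'_nat_eq_if_mod_eight,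
        if_neg (by omega), if_pos (Or.inr hq8)]
      rfl
  obtain ⟨γ, hγ⟩ := ZMod.isSquare_of_jacobiSym_eq_one hJ
  have h5 : (5 : ZMod q) ≠ 0 := by
    intro h
    have := (ZMod.natCast_eq_zero_iff 5 q).1 (by exact_mod_cast h)
    have := Nat.le_of_dvd (by norm_num) this
    omega
  obtain ⟨β, hβ⟩ := ZMod.intCast_surjective (γ / 5)
  have h25 : (q : ℤ) ∣ 25 * β ^ 2 + κ * N := by
    rw [← ZMod.intCast_zmod_eq_zero_iff_dvd]
    push_cast at hγ ⊢
    have hβ' : 5 * (β : ZMod q) = γ := by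
      rw [hβ]
      field_simp
    linear_combination (5 * β + γ) * hβ' - hγ
  obtain ⟨j, hj⟩ := hdvd
  have hj0 : 0 < j := by
    rcases Nat.eq_zero_or_pos j with rfl | h
    · omega
    · exact h
  have hjz : (q : ℤ) + 5 = 4 * κ * N * j := by exact_mod_cast hj
  have hqN : IsCoprime (q : ℤ) N := by
    rw [Nat.isCoprime_iff_coprime, Nat.Prime.coprime_iff_not_dvd hqp]
    intro h
    have h1 : q ∣ q + 5 := hj ▸ (h.mul_left (4 * κ)).mul_right j
    have := Nat.le_of_dvd (by norm_num) ((Nat.dvd_add_right dvd_rfl).1 h1)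
    omega
  obtain ⟨b, hb⟩ : (q : ℤ) ∣ 20 * κ * j * β ^ 2 + κ := by
    refine hqN.dvd_of_dvd_mul_left ?_
    have : (N : ℤ) * (20 * κ * j * β ^ 2 + κ) = q * (5 * β ^ 2) + (25 * β ^ 2 + κ * N) := by
      linear_combination -5 * β ^ 2 * hjz
    rw [this]
    exact dvd_add (dvd_mul_right _ _) h25
  exact ⟨q, j, β, b, by omega, by omega, hjz, hb.symm⟩

lemma zmod_five_eq_zero_of_form_eq_zero : ∀ N κ : ZMod 5, N * κ = 2 ∨ N * κ = 3 →
    ∀ A b : ZMod 5, A * b * N = κ → ∀ x y : ZMod 5, A * x ^ 2 + b * y ^ 2 = 0 →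
    x = 0 ∧ y = 0 := by
  decide

lemma zmod_five_mul_sq_ne : ∀ N κ : ZMod 5, N * κ = 2 ∨ N * κ = 3 →
    ∀ z : ZMod 5, N * z ^ 2 ≠ κ := by
  decide

/-- A positive definite form of determinant `5 * κ` with value `5 * N` and no value congruent to
`5 * κ` modulo `25`. -/
lemma exists_form {N κ : ℕ} (hN : Odd N)
    (hκ : κ = 1 ∧ (N % 5 = 2 ∨ N % 5 = 3) ∨ κ = 2 ∧ (N % 5 = 1 ∨ N % 5 = 4)) :
    ∃ F : TernaryForm, 0 < F.a ∧ 0 < F.minor ∧ F.det = 5 * κ ∧ F.eval 0 0 1 = 5 * N ∧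
      ∀ x y z, F.eval x y z % 25 ≠ 5 * κ := by
  obtain ⟨q, j, β, b, hq, hj, hqj, hb⟩ := exists_form_data hN hκ
  have hκ0 : (0 : ℤ) < κ := by omega
  have hb0 : 0 < b := pos_of_mul_pos_right (show 0 < q * b by rw [hb]; positivity) hq.le
  refine ⟨⟨4 * κ * j, b, 5 * N, -5 * β, 5, 0⟩, by positivity, ?_, ?_, ?_, fun x y z h => ?_⟩
  · simp only [TernaryForm.minor]
    have : 0 < 4 * κ * j * b := by positivity
    linarith
  · simp only [TernaryForm.det]
    linear_combination -5 * b * hqj + 5 * hb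
  · simp [TernaryForm.eval]
  · simp only [TernaryForm.eval] at h
    have hNκ : (N : ZMod 5) * κ = 2 ∨ (N : ZMod 5) * κ = 3 := by
      rw [← ZMod.natCast_mod N 5]
      rcases hκ with ⟨rfl, h | h⟩ | ⟨rfl, h | h⟩ <;> rw [h] <;> decide
    have h1 : ((4 * κ * j : ℤ) : ZMod 5) * (b : ZMod 5) * (N : ZMod 5) = κ := by
      have e1 := congrArg (Int.cast : ℤ → ZMod 5) hqj
      have e2 := congrArg (Int.cast : ℤ → ZMod 5) hb
      push_cast at e1 e2 ⊢
      have e5 : (5 : ZMod 5) = 0 := by decide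
      linear_combination -b * e1 + e2 + (b + 4 * κ * j * β ^ 2) * e5
    have h2 : ((4 * κ * j : ℤ) : ZMod 5) * (x : ZMod 5) ^ 2 +
        (b : ZMod 5) * (y : ZMod 5) ^ 2 = 0 := by
      have : (5 : ℤ) ∣ 4 * κ * j * x ^ 2 + b * y ^ 2 := by
        have h3 : (5 : ℤ) ∣ 4 * κ * j * x ^ 2 + b * y ^ 2 +
            5 * (N * z ^ 2 - 2 * β * y * z + 2 * x * z) := by
          rw [show 4 * κ * j * x ^ 2 + b * y ^ 2 + 5 * (N * z ^ 2 - 2 * β * y * z + 2 * x * z) =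
            4 * κ * j * x ^ 2 + b * y ^ 2 + 5 * N * z ^ 2 + 2 * (-5 * β) * y * z +
              2 * 5 * x * z + 2 * 0 * x * y by ring]
          omega
        exact (Int.dvd_iff_dvd_of_dvd_add h3).2 (dvd_mul_right _ _)
      have := (ZMod.intCast_zmod_eq_zero_iff_dvd _ 5).2 (by exact_mod_cast this)
      push_cast at this ⊢
      exact this
    obtain ⟨hx, hy⟩ := zmod_five_eq_zero_of_form_eq_zero _ _ hNκ _ _ h1 _ _ h2
    obtain ⟨x, rfl⟩ := (ZMod.intCast_zmod_eq_zero_iff_dvd _ 5).1 hx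
    obtain ⟨y, rfl⟩ := (ZMod.intCast_zmod_eq_zero_iff_dvd _ 5).1 hy
    refine zmod_five_mul_sq_ne _ _ hNκ z ?_
    have h4 : (5 : ℤ) ∣ N * z ^ 2 - κ := by
      have : 4 * κ * j * ((5 : ℕ) * x) ^ 2 + b * ((5 : ℕ) * y) ^ 2 + 5 * N * z ^ 2 +
          2 * (-5 * β) * ((5 : ℕ) * y) * z + 2 * 5 * ((5 : ℕ) * x) * z +
          2 * 0 * ((5 : ℕ) * x) * ((5 : ℕ) * y) =
        25 * (4 * κ * j * x ^ 2 + b * y ^ 2 - 2 * β * y * z + 2 * x * z) + 5 * (N * z ^ 2) := by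
        push_cast; ring
      rw [this] at h
      omega
    have := (ZMod.intCast_zmod_eq_zero_iff_dvd _ 5).2 (by exact_mod_cast h4)
    push_cast at this
    exact sub_eq_zero.1 this

/-- Natural numbers congruent to `±1` modulo `5` have the form
`s ^ 2 + 5 * z ^ 2 + 10 * w ^ 2`. -/
theorem exists_sq_add_five_mul_sq_add_ten_mul_sq {N : ℕ} (hN : N % 5 = 1 ∨ N % 5 = 4) :
    ∃ s z w : ℤ, (N : ℤ) = s ^ 2 + 5 * z ^ 2 + 10 * w ^ 2 := by
  induction N using Nat.strong_induction_on with
  | _ N ih =>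
  by_cases h4 : 4 ∣ N
  · obtain ⟨M, rfl⟩ := h4
    obtain ⟨s, z, w, h⟩ := ih M (by omega) (by omega)
    exact ⟨2 * s, 2 * z, 2 * w, by push_cast; linear_combination 4 * h⟩
  obtain ⟨r, s, t, h⟩ : ∃ r s t : ℤ, 5 * (N : ℤ) = r ^ 2 + 2 * s ^ 2 + 5 * t ^ 2 := by
    rcases Nat.even_or_odd' N with ⟨M, rfl | rfl⟩
    · obtain ⟨F, ha, hA, hd, hv, hval⟩ := exists_form (N := M) (κ := 1)
        (Nat.odd_iff.2 (by omega)) (by omega)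
      obtain ⟨r, s, t, h⟩ := TernaryForm.exists_eval_eq_of_det_eq_five ha hA hd hval 0 0 1
      refine ⟨2 * s + t, r, t, ?_⟩
      push_cast
      linear_combination 2 * h - 2 * hv
    · obtain ⟨F, ha, hA, hd, hv, hval⟩ := exists_form (N := 2 * M + 1) (κ := 2)
        (odd_two_mul_add_one M) (by omega)
      obtain ⟨r, s, t, h⟩ := TernaryForm.exists_eval_eq_of_det_eq_ten ha hA hd
        ⟨0, 0, 1, by rw [hv]; push_cast; omega⟩ hval 0 0 1
      exact ⟨r, s, t, by rw [← h, hv]⟩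
  have hrs : (5 : ℤ) ∣ r ^ 2 + 2 * s ^ 2 := by omega
  have key : ∀ r s : ZMod 5, r ^ 2 + 2 * s ^ 2 = 0 → r = 0 ∧ s = 0 := by decide
  obtain ⟨hr, hs⟩ := key r s (by
    have := (ZMod.intCast_zmod_eq_zero_iff_dvd _ 5).2 (by exact_mod_cast hrs)
    push_cast at this
    exact this)
  obtain ⟨r, rfl⟩ := (ZMod.intCast_zmod_eq_zero_iff_dvd _ 5).1 hr
  obtain ⟨s, rfl⟩ := (ZMod.intCast_zmod_eq_zero_iff_dvd _ 5).1 hs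
  refine ⟨t, r, s, ?_⟩
  push_cast at h
  linarith

/-- A prime whose square is close to `5 * n` yields a representation of `n`. -/
theorem exists_rep_of_prime {n p : ℕ} (hp : p.Prime) (hp5 : p ≠ 5) (h1 : 4 * n ≤ p ^ 2)
    (h2 : p ^ 2 ≤ 5 * n) : ∃ x y z w p : ℕ, p.Prime ∧
      n = x ^ 2 + y ^ 2 + z ^ 2 + 2 * w ^ 2 ∧ x + 2 * y = p := by
  have h5 : p % 5 ≠ 0 := fun h => hp5
    ((Nat.prime_dvd_prime_iff_eq Nat.prime_five hp).1 (Nat.dvd_of_mod_eq_zero h)).symm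
  have hp2 : p ^ 2 % 5 = 1 ∨ p ^ 2 % 5 = 4 := by
    rw [Nat.pow_mod]
    have := Nat.mod_lt p (show 0 < 5 by norm_num)
    interval_cases p % 5 <;> simp_all
  obtain ⟨s, z, w, h⟩ := exists_sq_add_five_mul_sq_add_ten_mul_sq (N := 5 * n - p ^ 2) (by omega)
  rw [Nat.cast_sub h2] at h
  push_cast at h
  wlog hs : (s - 2 * p) % 5 = 0 generalizing s
  · refine this (-s) (by linarith [neg_sq s]) ?_
    have h3 : (5 : ℤ) ∣ (s - 2 * p) * (s + 2 * p) :=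
      ⟨n - p ^ 2 - z ^ 2 - 2 * w ^ 2, by linear_combination -h⟩
    rcases Int.Prime.dvd_mul' Nat.prime_five (by exact_mod_cast h3) with h | h
    · omega
    · omega
  obtain ⟨k, hk⟩ := Int.dvd_of_emod_eq_zero hs
  obtain rfl : s = 2 * p + 5 * k := by linarith
  have hn : (4 : ℤ) * n ≤ p ^ 2 := by exact_mod_cast h1
  have hs2 : (2 * (2 * p + 5 * k)) ^ 2 ≤ (p : ℤ) ^ 2 := by nlinarith [sq_nonneg z, sq_nonneg w]
  obtain ⟨hs3, hs4⟩ := abs_le.1 (abs_le_of_sq_le_sq hs2 (by positivity))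
  obtain ⟨x, hx⟩ := Int.eq_ofNat_of_zero_le (show 0 ≤ (p : ℤ) + 2 * k by omega)
  obtain ⟨y, hy⟩ := Int.eq_ofNat_of_zero_le (show 0 ≤ -k by omega)
  refine ⟨x, y, z.natAbs, w.natAbs, p, hp, ?_, by omega⟩
  zify
  rw [sq_abs, sq_abs, ← hx, ← hy]
  linarith

end PrimeRestriction

theorem sums_of_squares_x_plus_2y_prime (n : ℕ) (hn : 0 < n) :
    ∃ x y z w p : ℕ, Nat.Prime p ∧
      n = x ^ 2 + y ^ 2 + z ^ 2 + 2 * w ^ 2 ∧ x + 2 * y = p := by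
  rcases lt_or_ge n 4033 with h | h
  · rcases exists_rep_or_prime_of_lt hn h with ⟨r, hr, h1, h2⟩ | ⟨p, hp, hp5, h1, h2⟩
    · exact exists_rep_of_mem_sporadicRanges hr h1 h2
    · exact exists_rep_of_prime hp hp5 h1 h2
  · obtain ⟨p, hp, h1, h2⟩ := exists_prime_sq_mem_Icc h
    exact exists_rep_of_prime hp (by rintro rfl; omega) h1 h2
end

section
/- Every integer n > 2 can be written as n = x^2 + y^2 + z^2 + 2w^2 with x, y, z, w nonnegative integers such that x + w is prime. -/
/-- Gauss reduction of a positive definite binary quadratic form. -/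
theorem exists_reduced_binary_form (A B C D : ℤ) (hA : 0 < A) (hD : 0 < D)
    (h : A * C - B ^ 2 = D) :
    ∃ p q r s : ℤ, p * s - q * r = 1 ∧ 0 < A * p ^ 2 + 2 * B * p * q + C * q ^ 2 ∧
      3 * (A * p ^ 2 + 2 * B * p * q + C * q ^ 2) ^ 2 ≤ 4 * D := by
  induction hN : A.toNat using Nat.strong_induction_on generalizing A B C with
  | _ N ih =>
  subst hN
  obtain ⟨j, hj1, hj2⟩ : ∃ j : ℤ, -A ≤ 2 * (B - j * A) ∧ 2 * (B - j * A) ≤ A := by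
    refine ⟨(2 * B + A) / (2 * A), ?_, ?_⟩
    · have := Int.emod_nonneg (2 * B + A) (b := 2 * A) (by positivity)
      have := Int.emod_add_mul_ediv (2 * B + A) (2 * A)
      linarith
    · have := Int.emod_lt_of_pos (2 * B + A) (b := 2 * A) (by positivity)
      have := Int.emod_add_mul_ediv (2 * B + A) (2 * A)
      linarith
  set B' := B - j * A with hB'
  set C' := C - 2 * j * B + j ^ 2 * A with hC'
  have hdet : A * C' - B' ^ 2 = D := by rw [← h, hB', hC']; ring
  have hC'pos : 0 < C' := by
    by_contra! hle
    nlinarith [sq_nonneg B', mul_nonneg hA.le (neg_nonneg.mpr hle)]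
  by_cases hlt : C' < A
  · obtain ⟨p, q, r, s, hps, hpos, hle⟩ :=
      ih C'.toNat (by omega) C' (-B') A hC'pos (by rw [← hdet]; ring) rfl
    have e : A * (q + j * p) ^ 2 + 2 * B * (q + j * p) * (-p) + C * (-p) ^ 2 =
        C' * p ^ 2 + 2 * (-B') * p * q + A * q ^ 2 := by rw [hB', hC']; ring
    exact ⟨q + j * p, -p, s + j * r, -r, by rw [← hps]; ring, e ▸ hpos, e ▸ hle⟩
  · refine ⟨1, 0, 0, 1, by ring, by simpa using hA, ?_⟩
    have h1 : 4 * B' ^ 2 ≤ A ^ 2 := by nlinarith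
    have h2 : A * A ≤ A * C' := mul_le_mul_of_nonneg_left (not_lt.mp hlt) hA.le
    nlinarith

/-- A positive definite binary form of determinant `1` takes only sums of two squares as values. -/
theorem binary_form_eq_sum_two_squares (A B C : ℤ) (hA : 0 < A) (h : A * C - B ^ 2 = 1)
    (x y : ℤ) : ∃ u v : ℤ, A * x ^ 2 + 2 * B * x * y + C * y ^ 2 = u ^ 2 + v ^ 2 := by
  obtain ⟨p, q, r, s, hps, hpos, hle⟩ := exists_reduced_binary_form A B C 1 hA one_pos h
  have h1 : A * p ^ 2 + 2 * B * p * q + C * q ^ 2 = 1 := by nlinarith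
  set X := s * x - r * y with hX
  set Y := p * y - q * x with hY
  have hx : x = p * X + r * Y := by rw [hX, hY]; linear_combination (-x) * hps
  have hy : y = q * X + s * Y := by rw [hX, hY]; linear_combination (-y) * hps
  clear_value X Y
  subst hx hy
  set E := A * p * r + B * (p * s + q * r) + C * q * s with hE
  have hdet : A * r ^ 2 + 2 * B * r * s + C * s ^ 2 - E ^ 2 = 1 := by
    have : (A * p ^ 2 + 2 * B * p * q + C * q ^ 2) * (A * r ^ 2 + 2 * B * r * s + C * s ^ 2)
        - E ^ 2 = (A * C - B ^ 2) * (p * s - q * r) ^ 2 := by rw [hE]; ring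
    rw [h1, h, hps] at this
    linarith
  refine ⟨X + E * Y, Y, ?_⟩
  have : A * (p * X + r * Y) ^ 2 + 2 * B * (p * X + r * Y) * (q * X + s * Y)
      + C * (q * X + s * Y) ^ 2 = (A * p ^ 2 + 2 * B * p * q + C * q ^ 2) * X ^ 2
      + 2 * E * X * Y + (A * r ^ 2 + 2 * B * r * s + C * s ^ 2) * Y ^ 2 := by
    rw [hE]; ring
  rw [this, h1]
  linear_combination Y ^ 2 * hdet

/-- Hermite's bound for the leading coefficient of a reduced ternary form of determinant `9`. -/
theorem eq_one_of_reduced {a b f g l : ℤ} (ha : 0 < a) (h₁ : -a ≤ 2 * f) (h₂ : 2 * f ≤ a)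
    (hab : a * b - f ^ 2 = g) (hg : 3 * g ^ 2 ≤ 4 * (9 * a)) (hle : a ≤ b)
    (hl : (3 : ℤ) ∣ a - l ^ 2) : a = 1 := by
  have h1 : 4 * f ^ 2 ≤ a ^ 2 := by nlinarith
  have h2 : a * a ≤ a * b := mul_le_mul_of_nonneg_left hle ha.le
  have h3 : 3 * a ^ 2 ≤ 4 * g := by nlinarith
  have h4 : (3 * a ^ 2) ^ 2 ≤ (4 * g) ^ 2 := pow_le_pow_left₀ (by positivity) h3 2
  have h5 : a * (3 * a ^ 3) ≤ a * 64 := by nlinarith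
  have h6 : a ≤ 2 := by
    by_contra! h7
    have h8 : 3 ^ 3 ≤ a ^ 3 := pow_le_pow_left₀ (by norm_num) h7 3
    have h9 := le_of_mul_le_mul_left h5 ha
    linarith
  by_contra h7
  obtain rfl : a = 2 := by omega
  have hm : l % 3 = 0 ∨ l % 3 = 1 ∨ l % 3 = 2 := by omega
  have := Int.emod_eq_zero_of_dvd hl
  rcases hm with hm | hm | hm <;> simp [pow_two, Int.sub_emod, Int.mul_emod, hm] at this

/-- A positive definite ternary form of determinant `9` that is the square of a linear form
modulo `3` takes only values of the form `t ^ 2 + 3 * u ^ 2 + 3 * v ^ 2`. -/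
theorem ternary_form_value (a b c d e f l₁ l₂ l₃ : ℤ) (ha : 0 < a) (hab : 0 < a * b - f ^ 2)
    (hdet : a * b * c + 2 * d * e * f - a * d ^ 2 - b * e ^ 2 - c * f ^ 2 = 9)
    (h₁ : (3 : ℤ) ∣ a - l₁ ^ 2) (h₂ : (3 : ℤ) ∣ b - l₂ ^ 2) (h₃ : (3 : ℤ) ∣ c - l₃ ^ 2)
    (h₂₃ : (3 : ℤ) ∣ d - l₂ * l₃) (h₁₃ : (3 : ℤ) ∣ e - l₁ * l₃) (h₁₂ : (3 : ℤ) ∣ f - l₁ * l₂)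
    (x y z : ℤ) :
    ∃ t u v : ℤ, a * x ^ 2 + b * y ^ 2 + c * z ^ 2 + 2 * d * y * z + 2 * e * x * z
      + 2 * f * x * y = t ^ 2 + 3 * u ^ 2 + 3 * v ^ 2 := by
  induction hN : a.toNat using Nat.strong_induction_on
    generalizing a b c d e f l₁ l₂ l₃ x y z with
  | _ N ih =>
  subst hN
  by_cases ha1 : a = 1
  · subst ha1
    obtain ⟨k₁, k₁'⟩ := h₁
    obtain ⟨k₂, k₂'⟩ := h₂
    obtain ⟨k₃, k₃'⟩ := h₃
    obtain ⟨k₂₃, k₂₃'⟩ := h₂₃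
    obtain ⟨k₁₃, k₁₃'⟩ := h₁₃
    obtain ⟨k₁₂, k₁₂'⟩ := h₁₂
    obtain ⟨A, hA⟩ : (3 : ℤ) ∣ b - f ^ 2 :=
      ⟨k₂ + k₁ * l₂ ^ 2 - k₁₂ * (f + l₁ * l₂),
        by linear_combination k₂' + l₂ ^ 2 * k₁' - (f + l₁ * l₂) * k₁₂'⟩
    obtain ⟨C, hC⟩ : (3 : ℤ) ∣ c - e ^ 2 :=
      ⟨k₃ + k₁ * l₃ ^ 2 - k₁₃ * (e + l₁ * l₃),
        by linear_combination k₃' + l₃ ^ 2 * k₁' - (e + l₁ * l₃) * k₁₃'⟩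
    obtain ⟨B, hB⟩ : (3 : ℤ) ∣ d - e * f :=
      ⟨k₂₃ + k₁ * l₂ * l₃ - k₁₃ * f - k₁₂ * l₁ * l₃,
        by linear_combination k₂₃' + l₂ * l₃ * k₁' - f * k₁₃' - l₁ * l₃ * k₁₂'⟩
    have hb : b = f ^ 2 + 3 * A := by linarith
    have hc : c = e ^ 2 + 3 * C := by linarith
    have hd : d = e * f + 3 * B := by linarith
    subst hb hc hd
    obtain ⟨u, v, huv⟩ := binary_form_eq_sum_two_squares A B C (by linarith) (by linarith) y z
    exact ⟨x + f * y + e * z, u, v, by linear_combination 3 * huv⟩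
  have hG : (a * b - f ^ 2) * (a * c - e ^ 2) - (a * d - e * f) ^ 2 = 9 * a := by
    rw [← hdet]; ring
  obtain ⟨p, q, r, s, hps, hpos, hle⟩ := exists_reduced_binary_form _ _ _ _ hab (by omega) hG
  set g := (a * b - f ^ 2) * p ^ 2 + 2 * (a * d - e * f) * p * q + (a * c - e ^ 2) * q ^ 2 with hg
  obtain ⟨j, hj1, hj2⟩ : ∃ j : ℤ, -a ≤ 2 * (f * p + e * q - j * a) ∧
      2 * (f * p + e * q - j * a) ≤ a := by
    refine ⟨(2 * (f * p + e * q) + a) / (2 * a), ?_, ?_⟩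
    · have := Int.emod_nonneg (2 * (f * p + e * q) + a) (b := 2 * a) (by positivity)
      have := Int.emod_add_mul_ediv (2 * (f * p + e * q) + a) (2 * a)
      linarith
    · have := Int.emod_lt_of_pos (2 * (f * p + e * q) + a) (b := 2 * a) (by positivity)
      have := Int.emod_add_mul_ediv (2 * (f * p + e * q) + a) (2 * a)
      linarith
  set f' := f * p + e * q - j * a with hf'
  set b' := b * p ^ 2 + 2 * d * p * q + c * q ^ 2 - 2 * j * (f * p + e * q) + j ^ 2 * a with hb'
  have hab' : a * b' - f' ^ 2 = g := by rw [hb', hf', hg]; ring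
  have hb'pos : 0 < b' := by
    by_contra! hle'
    nlinarith [sq_nonneg f', mul_nonneg ha.le (neg_nonneg.mpr hle')]
  by_cases hlt : b' < a
  · set e' := f * r + e * s with he'
    set d' := b * p * r + d * (p * s + q * r) + c * q * s - j * e' with hd'
    set c' := b * r ^ 2 + 2 * d * r * s + c * s ^ 2 with hc'
    have hdet' : b' * a * c' + 2 * e' * d' * f' - b' * e' ^ 2 - a * d' ^ 2 - c' * f' ^ 2 = 9 := by
      have : b' * a * c' + 2 * e' * d' * f' - b' * e' ^ 2 - a * d' ^ 2 - c' * f' ^ 2 =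
          (a * b * c + 2 * d * e * f - a * d ^ 2 - b * e ^ 2 - c * f ^ 2)
            * (p * s - q * r) ^ 2 := by
        rw [hb', hc', hd', he', hf']; ring
      rw [this, hdet, hps]; norm_num
    obtain ⟨k₁, k₁'⟩ := h₁
    obtain ⟨k₂, k₂'⟩ := h₂
    obtain ⟨k₃, k₃'⟩ := h₃
    obtain ⟨k₂₃, k₂₃'⟩ := h₂₃
    obtain ⟨k₁₃, k₁₃'⟩ := h₁₃
    obtain ⟨k₁₂, k₁₂'⟩ := h₁₂
    obtain ⟨t, u, v, htuv⟩ := ih b'.toNat (by omega) b' a c' e' d' f'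
      (l₂ * p + l₃ * q - j * l₁) l₁ (l₂ * r + l₃ * s) hb'pos (by linarith) hdet'
      ⟨k₂ * p ^ 2 + 2 * k₂₃ * p * q + k₃ * q ^ 2 - 2 * j * (k₁₂ * p + k₁₃ * q) + j ^ 2 * k₁, by
        rw [hb']
        linear_combination p ^ 2 * k₂' + 2 * p * q * k₂₃' + q ^ 2 * k₃' - 2 * j * p * k₁₂'
          - 2 * j * q * k₁₃' + j ^ 2 * k₁'⟩
      ⟨k₁, k₁'⟩
      ⟨k₂ * r ^ 2 + 2 * k₂₃ * r * s + k₃ * s ^ 2, by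
        rw [hc']
        linear_combination r ^ 2 * k₂' + 2 * r * s * k₂₃' + s ^ 2 * k₃'⟩
      ⟨k₁₂ * r + k₁₃ * s, by rw [he']; linear_combination r * k₁₂' + s * k₁₃'⟩
      ⟨k₂ * p * r + k₂₃ * (p * s + q * r) + k₃ * q * s - j * (k₁₂ * r + k₁₃ * s), by
        rw [hd', he']
        linear_combination p * r * k₂' + (p * s + q * r) * k₂₃' + q * s * k₃'
          - j * r * k₁₂' - j * s * k₁₃'⟩
      ⟨k₁₂ * p + k₁₃ * q - j * k₁, by
        rw [hf']; linear_combination p * k₁₂' + q * k₁₃' - j * k₁'⟩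
      (s * y - r * z) (x + j * (s * y - r * z)) (p * z - q * y) rfl
    refine ⟨t, u, v, ?_⟩
    rw [← htuv]
    set Y := s * y - r * z with hY
    set Z := p * z - q * y with hZ
    have hy : y = p * Y + r * Z := by rw [hY, hZ]; linear_combination (-y) * hps
    have hz : z = q * Y + s * Z := by rw [hY, hZ]; linear_combination (-z) * hps
    clear_value Y Z
    subst hy hz
    rw [hb', hc', hd', he', hf']
    ring
  · exact absurd (eq_one_of_reduced ha hj1 hj2 hab' hle (not_lt.mp hlt) h₁) ha1

/-- Primes `q ≡ -3 [MOD 4 * m]` have `-m` as a quadratic residue, if `m ≡ 1 [MOD 3]`. -/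
theorem isSquare_neg_of_modEq {m q k : ℕ} [hq : Fact q.Prime] (hm : m % 3 = 1)
    (hk : q + 3 = 4 * m * k) : IsSquare ((-m : ℤ) : ZMod q) := by
  have hq1 : q % 4 = 1 := by
    have : 4 * m * k = 4 * (m * k) := by ring
    omega
  have hodd : Odd q := Nat.odd_iff.mpr (by omega)
  have hodd' : Odd (4 * m - 3) := Nat.odd_iff.mpr (by omega)
  have hmod : q % (4 * m) = (4 * m - 3) % (4 * m) := by
    have h : q + 3 ≡ (4 * m - 3) + 3 [MOD 4 * m] := by
      rw [hk, Nat.sub_add_cancel (by omega)]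
      exact ((Nat.modEq_zero_iff_dvd).mpr (dvd_mul_right _ _)).trans
        ((Nat.modEq_zero_iff_dvd).mpr dvd_rfl).symm
    exact h.add_right_cancel' 3
  apply ZMod.isSquare_of_jacobiSym_eq_one
  rw [jacobiSym.neg _ hodd, ZMod.χ₄_nat_one_mod_four hq1, one_mul, jacobiSym.mod_right' m hodd,
    hmod, ← jacobiSym.mod_right' m hodd']
  have h4 : jacobiSym 4 (4 * m - 3) = 1 := jacobiSym.at_four hodd'
  calc jacobiSym m (4 * m - 3) = jacobiSym (4 * m : ℤ) (4 * m - 3) := by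
        rw [jacobiSym.mul_left, h4, one_mul]
    _ = jacobiSym ((3 : ℕ) : ℤ) (4 * m - 3) := by
        apply jacobiSym.mod_left'
        rw [Nat.cast_sub (by omega)]
        push_cast
        rw [Int.emod_eq_emod_iff_emod_sub_eq_zero, Int.emod_self]
    _ = jacobiSym ((4 * m - 3 : ℕ) : ℤ) 3 :=
        jacobiSym.quadratic_reciprocity_one_mod_four' (by decide) (by omega)
    _ = jacobiSym 1 3 := by
        apply jacobiSym.mod_left'
        omega
    _ = 1 := jacobiSym.one_left 3

/-- Every positive integer congruent to `1` modulo `3` is represented by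
`t ^ 2 + 3 * u ^ 2 + 3 * v ^ 2`. -/
theorem exists_eq_sq_add_three_mul_sq_add_three_mul_sq {m : ℕ} (hm : m % 3 = 1) :
    ∃ t u v : ℤ, (m : ℤ) = t ^ 2 + 3 * u ^ 2 + 3 * v ^ 2 := by
  obtain ⟨q, hq3, hq, hqm⟩ := Nat.forall_exists_prime_gt_and_zmodEq 3 (q := 4 * m) (a := -3)
    (by omega) (by
      apply IsCoprime.neg_left
      have : Nat.Coprime 3 (4 * m) := by
        rw [Nat.Prime.coprime_iff_not_dvd Nat.prime_three]; omega
      exact_mod_cast Nat.isCoprime_iff_coprime.mpr this)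
  obtain ⟨k, hk⟩ : 4 * m ∣ q + 3 := by
    have h := hqm.symm.dvd
    zify
    have h2 : ((q : ℤ) - -3) = q + 3 := by ring
    rw [h2] at h
    exact_mod_cast h
  have := Fact.mk hq
  obtain ⟨r, hr⟩ := isSquare_neg_of_modEq hm hk
  have h3 : (3 : ZMod q) ≠ 0 := by
    intro h
    have : ((3 : ℕ) : ZMod q) = 0 := by exact_mod_cast h
    rw [ZMod.natCast_eq_zero_iff] at this
    exact absurd (Nat.le_of_dvd (by norm_num) this) (by omega)
  have hkm : (4 * k * m : ZMod q) = 3 := by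
    have : ((q + 3 : ℕ) : ZMod q) = ((4 * m * k : ℕ) : ZMod q) := by rw [hk]
    push_cast at this
    rw [ZMod.natCast_self, zero_add] at this
    rw [this]; ring
  obtain ⟨β, hβ⟩ := ZMod.intCast_surjective (r * (4 * k) / 3 : ZMod q)
  obtain ⟨a, ha⟩ : (q : ℤ) ∣ 4 * k + 3 * β ^ 2 := by
    rw [← ZMod.intCast_zmod_eq_zero_iff_dvd]
    push_cast at hr ⊢
    rw [hβ]
    field_simp
    linear_combination (-(16 * (k : ZMod q) ^ 2)) * hr - 4 * (k : ZMod q) * hkm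
  have hkpos : 0 < k := Nat.pos_of_ne_zero (by rintro rfl; omega)
  have hapos : 0 < a := by
    have : 0 < (q : ℤ) * a := by rw [← ha]; positivity
    exact (mul_pos_iff_of_pos_left (by exact_mod_cast hq.pos)).mp this
  have hk' : (q : ℤ) + 3 = 4 * m * k := by exact_mod_cast hk
  have hk3 : ¬ (3 : ℤ) ∣ 4 * k := by
    intro h
    have : (3 : ℤ) ∣ q := by
      have e : (q : ℤ) = 4 * k * m - 3 := by linear_combination hk'
      rw [e]
      exact dvd_sub (h.mul_right _) dvd_rfl
    have := (Nat.prime_dvd_prime_iff_eq Nat.prime_three hq).mp (by exact_mod_cast this)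
    omega
  have ha1 : (3 : ℤ) ∣ a - 1 := by
    have hm' : (3 : ℤ) ∣ m - 1 := by omega
    have : (3 : ℤ) ∣ (4 * k) * (a - 1) := by
      obtain ⟨w, hw⟩ := hm'
      exact ⟨β ^ 2 + a - 4 * k * w * a, by
        linear_combination (-1 : ℤ) * ha - a * hk' - 4 * k * a * hw⟩
    exact (Int.prime_three.dvd_or_dvd this).resolve_left hk3
  have hm1 : (3 : ℤ) ∣ m - 1 := by omega
  obtain ⟨t, u, v, h⟩ := ternary_form_value a (3 * q) m 0 1 (3 * β) 1 0 1 hapos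
    (by
      have : a * (3 * q) - (3 * β) ^ 2 = 3 * (4 * k) := by linear_combination (-3) * ha
      rw [this]; positivity)
    (by linear_combination (-3 * m) * ha - 3 * hk')
    (by simpa using ha1) ⟨q, by ring⟩ (by simpa using hm1) ⟨0, by ring⟩ ⟨0, by ring⟩
    ⟨β, by ring⟩ 0 0 1
  exact ⟨t, u, v, by rw [← h]; ring⟩

open ArithmeticFunction in
theorem log_factorial_eq_sum_vonMangoldt (K : ℕ) {N : ℕ} (hKN : K ≤ N) :
    Real.log (K.factorial) = ∑ d ∈ Finset.Ioc 0 N, Λ d * ((K / d : ℕ) : ℝ) := by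
  have h1 : Real.log (K.factorial) = ∑ d ∈ Finset.Ioc 0 K, Λ d * ((K / d : ℕ) : ℝ) := by
    rw [← sum_Ioc_mul_zeta_eq_sum, vonMangoldt_mul_zeta]
    clear hKN
    induction K with
    | zero => simp
    | succ K ih =>
      rw [← Order.succ_eq_add_one, ← Finset.insert_Ioc_right_eq_Ioc_succ (Nat.zero_le K),
        Finset.sum_insert (by simp), ← ih, Order.succ_eq_add_one, Nat.factorial_succ, Nat.cast_mul,
        Real.log_mul (by positivity) (by positivity)]
      rfl
  rw [h1]
  apply Finset.sum_subset (Finset.Ioc_subset_Ioc_right hKN)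
  intro d hd hd'
  simp only [Finset.mem_Ioc, not_and, not_le] at hd hd'
  rw [Nat.div_eq_of_lt (hd' hd.1)]
  simp

/-- Chebyshev's combination of factorials
`log (N! ⌊N/30⌋! / (⌊N/2⌋! ⌊N/3⌋! ⌊N/5⌋!))`. -/
noncomputable def chebyshevLogRatio (N : ℕ) : ℝ :=
  Real.log (N.factorial) + Real.log ((N / 30).factorial) - Real.log ((N / 2).factorial)
    - Real.log ((N / 3).factorial) - Real.log ((N / 5).factorial)

open ArithmeticFunction in
theorem chebyshevLogRatio_eq_sum (N : ℕ) :
    chebyshevLogRatio N = ∑ d ∈ Finset.Ioc 0 N,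
      Λ d * (((N / d + N / d / 30 - N / d / 2 - N / d / 3 - N / d / 5 : ℤ)) : ℝ) := by
  rw [chebyshevLogRatio, log_factorial_eq_sum_vonMangoldt N le_rfl,
    log_factorial_eq_sum_vonMangoldt (N / 30) (Nat.div_le_self N 30),
    log_factorial_eq_sum_vonMangoldt (N / 2) (Nat.div_le_self N 2),
    log_factorial_eq_sum_vonMangoldt (N / 3) (Nat.div_le_self N 3),
    log_factorial_eq_sum_vonMangoldt (N / 5) (Nat.div_le_self N 5),
    ← Finset.sum_add_distrib, ← Finset.sum_sub_distrib, ← Finset.sum_sub_distrib,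
    ← Finset.sum_sub_distrib]
  refine Finset.sum_congr rfl fun d _ ↦ ?_
  rw [Nat.div_right_comm N 30, Nat.div_right_comm N 2, Nat.div_right_comm N 3,
    Nat.div_right_comm N 5]
  have h (k : ℕ) : ((N / d / k : ℕ) : ℝ) = ((N / d / k : ℤ) : ℝ) := by
    rw [← Int.cast_natCast]; push_cast; rfl
  have h' : ((N / d : ℕ) : ℝ) = ((N / d : ℤ) : ℝ) := by
    rw [← Int.cast_natCast]; push_cast; rfl
  rw [h, h, h, h, h']
  push_cast
  ring

theorem chebyshevLogRatio_le_psi (N : ℕ) : chebyshevLogRatio N ≤ Chebyshev.psi N := by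
  rw [chebyshevLogRatio_eq_sum, Chebyshev.psi, Nat.floor_natCast]
  refine Finset.sum_le_sum fun d _ ↦ ?_
  refine mul_le_of_le_one_right ArithmeticFunction.vonMangoldt_nonneg ?_
  have : (N / d + N / d / 30 - N / d / 2 - N / d / 3 - N / d / 5 : ℤ) ≤ 1 := by omega
  exact_mod_cast this

theorem psi_sub_psi_div_six_le (N : ℕ) :
    Chebyshev.psi N - Chebyshev.psi ((N / 6 : ℕ) : ℝ) ≤ chebyshevLogRatio N := by
  rw [chebyshevLogRatio_eq_sum, Chebyshev.psi, Chebyshev.psi, Nat.floor_natCast, Nat.floor_natCast,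
    sub_le_iff_le_add, ← Finset.sum_sdiff (Finset.Ioc_subset_Ioc_right (a := 0)
      (Nat.div_le_self N 6)), ← Finset.sum_sdiff (f := fun d ↦ ArithmeticFunction.vonMangoldt d * _)
      (Finset.Ioc_subset_Ioc_right (a := 0) (Nat.div_le_self N 6))]
  have h1 : ∀ d ∈ Finset.Ioc 0 N \ Finset.Ioc 0 (N / 6), ArithmeticFunction.vonMangoldt d ≤
      ArithmeticFunction.vonMangoldt d *
        (((N / d + N / d / 30 - N / d / 2 - N / d / 3 - N / d / 5 : ℤ)) : ℝ) := by
    intro d hd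
    simp only [Finset.mem_sdiff, Finset.mem_Ioc, not_and, not_le] at hd
    have hd6 := hd.2 hd.1.1
    refine le_mul_of_one_le_right ArithmeticFunction.vonMangoldt_nonneg ?_
    have h2 : N / d < 6 := by
      rw [Nat.div_lt_iff_lt_mul hd.1.1]; omega
    have h3 : 1 ≤ N / d := by
      rw [Nat.one_le_div_iff hd.1.1]; exact hd.1.2
    have h4 : (N / d : ℤ) = ((N / d : ℕ) : ℤ) := by push_cast; rfl
    have : 1 ≤ (N / d + N / d / 30 - N / d / 2 - N / d / 3 - N / d / 5 : ℤ) := by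
      rw [h4]; omega
    exact_mod_cast this
  have h2 : ∀ d ∈ Finset.Ioc 0 (N / 6), 0 ≤ ArithmeticFunction.vonMangoldt d *
        (((N / d + N / d / 30 - N / d / 2 - N / d / 3 - N / d / 5 : ℤ)) : ℝ) := by
    intro d _
    refine mul_nonneg ArithmeticFunction.vonMangoldt_nonneg ?_
    have h4 : (N / d : ℤ) = ((N / d : ℕ) : ℤ) := by push_cast; rfl
    have : 0 ≤ (N / d + N / d / 30 - N / d / 2 - N / d / 3 - N / d / 5 : ℤ) := by
      rw [h4]; omega
    exact_mod_cast this
  have := Finset.sum_le_sum h1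
  have := Finset.sum_nonneg h2
  linarith

theorem mul_log_sub_self_tangent {x y : ℝ} (hx : 0 < x) (hy : 0 < y) :
    y * Real.log y - y + (x - y) * Real.log y ≤ x * Real.log x - x := by
  have h := Real.one_sub_inv_le_log_of_pos (div_pos hx hy)
  rw [Real.log_div hx.ne' hy.ne', inv_div] at h
  have h2 := mul_le_mul_of_nonneg_left h hx.le
  have h3 : x * (1 - y / x) = x - y := by field_simp
  rw [h3] at h2
  linarith

theorem log_factorial_le {n : ℕ} (hn : n ≠ 0) :
    Real.log n.factorial ≤ n * Real.log n - n + Real.log n + 1 := by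
  induction n with
  | zero => exact absurd rfl hn
  | succ n ih =>
    rcases eq_or_ne n 0 with rfl | h0
    · simp
    have hn' : (0 : ℝ) < n := by positivity
    have h1 := ih h0
    have h2 := mul_log_sub_self_tangent (x := n + 1) (y := n) (by positivity) hn'
    rw [Nat.factorial_succ, Nat.cast_mul, Real.log_mul (by positivity) (by positivity)]
    push_cast
    linarith

/-- A crude form of Stirling's formula for `⌊N / k⌋!`. -/
theorem log_factorial_div_bounds {N k : ℕ} (hk : 0 < k) (hkN : k ≤ N) :
    (N / k : ℝ) * (Real.log N - Real.log k) - N / k - Real.log N ≤ Real.log (N / k).factorial ∧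
    Real.log (N / k).factorial ≤
      (N / k : ℝ) * (Real.log N - Real.log k) - N / k + Real.log N + 1 := by
  have hN : 0 < N := by omega
  have hk' : (1 : ℝ) ≤ k := by exact_mod_cast hk
  have hkN' : (k : ℝ) ≤ N := by exact_mod_cast hkN
  have hN' : (0 : ℝ) < N := by positivity
  set x : ℝ := N / k with hx
  have hx1 : 1 ≤ x := by rw [hx, one_le_div (by positivity)]; exact hkN'
  have hx0 : 0 < x := by positivity
  have hlogx : Real.log N - Real.log k = Real.log x := by
    rw [hx, Real.log_div (by positivity) (by positivity)]
  have hlogk : 0 ≤ Real.log k := Real.log_nonneg hk'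
  have hm1 : 1 ≤ N / k := Nat.div_pos hkN hk
  have hm0 : N / k ≠ 0 := by omega
  set m := N / k with hm
  have hmx : (m : ℝ) ≤ x := Nat.cast_div_le
  have hxm : x < m + 1 := by
    rw [hx, div_lt_iff₀ (by positivity)]
    exact_mod_cast Nat.lt_mul_of_div_lt (Nat.lt_succ_self _) hk
  have hm1' : (1 : ℝ) ≤ m := by exact_mod_cast hm1
  have hlogm : 0 ≤ Real.log m := Real.log_nonneg hm1'
  have hlogx0 : 0 ≤ Real.log x := Real.log_nonneg hx1
  rw [hlogx]
  constructor
  · have h1 := Stirling.le_log_factorial_stirling hm0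
    have h2 := mul_log_sub_self_tangent (x := m) (y := x) (by positivity) hx0
    have h3 : 0 ≤ Real.log (2 * Real.pi) := Real.log_nonneg (by linarith [Real.pi_gt_three])
    nlinarith
  · have h1 := log_factorial_le hm0
    have h2 := mul_log_sub_self_tangent (x := x) (y := m) hx0 (by positivity)
    have h3 : Real.log m ≤ Real.log x := Real.log_le_log (by positivity) hmx
    nlinarith

/-- The constant `A = 0.92129…` in Chebyshev's estimates. -/
noncomputable def chebyshevConst : ℝ :=
  Real.log 2 / 2 + Real.log 3 / 3 + Real.log 5 / 5 - Real.log 30 / 30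

theorem chebyshevConst_ge : 0.85 ≤ chebyshevConst := by
  have h30 : Real.log 30 = Real.log 2 + Real.log 3 + Real.log 5 := by
    rw [← Real.log_mul (by norm_num) (by norm_num), ← Real.log_mul (by norm_num) (by norm_num)]
    norm_num
  have h3 : 1 ≤ Real.log 3 := by
    rw [Real.le_log_iff_exp_le (by norm_num)]
    linarith [Real.exp_one_lt_d9]
  have h5 : 2 * Real.log 2 ≤ Real.log 5 := by
    have h4 : 2 * Real.log 2 = Real.log (2 ^ 2) := by rw [Real.log_pow]; norm_num
    rw [h4]
    exact Real.log_le_log (by norm_num) (by norm_num)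
  rw [chebyshevConst, h30]
  linarith [Real.log_two_gt_d9]

theorem chebyshevLogRatio_bounds {N : ℕ} (hN : 30 ≤ N) :
    chebyshevConst * N - 5 * Real.log N - 3 ≤ chebyshevLogRatio N ∧
      chebyshevLogRatio N ≤ chebyshevConst * N + 5 * Real.log N + 3 := by
  have h1 := log_factorial_div_bounds (N := N) one_pos (by omega)
  have h2 := log_factorial_div_bounds (N := N) (k := 2) (by norm_num) (by omega)
  have h3 := log_factorial_div_bounds (N := N) (k := 3) (by norm_num) (by omega)
  have h5 := log_factorial_div_bounds (N := N) (k := 5) (by norm_num) (by omega)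
  have h30 := log_factorial_div_bounds (N := N) (k := 30) (by norm_num) (by omega)
  rw [Nat.div_one] at h1
  rw [chebyshevLogRatio, chebyshevConst]
  push_cast at h1 h2 h3 h5 h30
  rw [Real.log_one] at h1
  constructor
  · linarith [h1.1, h30.1, h2.2, h3.2, h5.2]
  · linarith [h1.2, h30.2, h2.1, h3.1, h5.1]

/-- Chebyshev's upper bound for `ψ`. -/
theorem psi_le_chebyshevConst_mul (N : ℕ) :
    Chebyshev.psi N ≤ 6 / 5 * chebyshevConst * N + 30 * √N := by
  induction N using Nat.strong_induction_on with
  | _ N ih =>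
  have hA := chebyshevConst_ge
  have hs := Real.sqrt_nonneg (N : ℝ)
  have hss := Real.sq_sqrt (Nat.cast_nonneg (α := ℝ) N)
  rcases lt_or_ge N 30 with h | h
  · have h1 := Chebyshev.psi_le_const_mul_self (Nat.cast_nonneg (α := ℝ) N)
    have h2 : Real.log 4 ≤ 1.4 := by
      have : Real.log 4 = 2 * Real.log 2 := by
        rw [show (4 : ℝ) = 2 ^ 2 by norm_num, Real.log_pow]; norm_num
      linarith [Real.log_two_lt_d9]
    have h3 : √(N : ℝ) ≤ 5.5 := by
      rw [Real.sqrt_le_iff]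
      have : (N : ℝ) ≤ 30 := by exact_mod_cast h.le
      constructor <;> norm_num
      linarith
    have h4 : 0 ≤ 6 / 5 * chebyshevConst * N := by positivity
    nlinarith
  · have h1 := ih (N / 6) (by omega)
    have h2 := psi_sub_psi_div_six_le N
    have h3 := (chebyshevLogRatio_bounds h).2
    have h4 : ((N / 6 : ℕ) : ℝ) ≤ N / 6 := by exact_mod_cast Nat.cast_div_le (m := N) (n := 6)
    have h5 : √((N / 6 : ℕ) : ℝ) ≤ 0.41 * √(N : ℝ) := by
      rw [Real.sqrt_le_iff]
      refine ⟨by positivity, ?_⟩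
      nlinarith
    have hN : (30 : ℝ) ≤ N := by exact_mod_cast h
    have h6 : Real.log N ≤ 2 * (√(N : ℝ) - 1) := by
      have h7 := Real.log_le_sub_one_of_pos (x := √(N : ℝ)) (by positivity)
      rw [Real.log_sqrt (by positivity)] at h7
      linarith
    have h8 : chebyshevConst * ((N / 6 : ℕ) : ℝ) ≤ chebyshevConst * (N / 6) :=
      mul_le_mul_of_nonneg_left h4 (by linarith)
    nlinarith

/-- A strengthening of Bertrand's postulate for large `N`, with ratio `61 / 50`. -/
theorem exists_prime_le_mul_of_large {N : ℕ} (hN : 25000000 ≤ N) :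
    ∃ p, p.Prime ∧ N < p ∧ 50 * p ≤ 61 * N := by
  by_contra! hno
  set M := 61 * N / 50 with hM
  have hθ : Chebyshev.theta M ≤ Chebyshev.theta N := by
    rw [Chebyshev.theta, Chebyshev.theta, Nat.floor_natCast, Nat.floor_natCast]
    refine Finset.sum_le_sum_of_subset_of_nonneg ?_ fun i _ _ ↦ Real.log_natCast_nonneg i
    intro p hp
    simp only [Finset.mem_filter, Finset.mem_Ioc] at hp ⊢
    refine ⟨⟨hp.1.1, ?_⟩, hp.2⟩
    by_contra! h
    have := hno p hp.2 h
    omega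
  have hA := chebyshevConst_ge
  have hN' : (25000000 : ℝ) ≤ N := by exact_mod_cast hN
  have hM1 : (M : ℝ) ≤ 1.22 * N := by
    have : 50 * M ≤ 61 * N := by omega
    have : (50 * M : ℝ) ≤ 61 * N := by exact_mod_cast this
    linarith
  have hM2 : 1.22 * N - 1 ≤ (M : ℝ) := by
    have : 61 * N ≤ 50 * M + 50 := by omega
    have : (61 * N : ℝ) ≤ 50 * M + 50 := by exact_mod_cast this
    linarith
  have hMpos : (1 : ℝ) ≤ M := by linarith
  have h1 := Chebyshev.psi_sub_theta_le hMpos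
  have h2 := Chebyshev.theta_le_psi N
  have h3 := psi_le_chebyshevConst_mul N
  have h4 := chebyshevLogRatio_le_psi M
  have h5 := (chebyshevLogRatio_bounds (N := M) (by omega)).1
  set s := √(N : ℝ) with hs
  have hss : s ^ 2 = N := Real.sq_sqrt (by positivity)
  have hs5 : 5000 ≤ s := by
    rw [hs]; apply Real.le_sqrt_of_sq_le; linarith
  have hsM : √(M : ℝ) ≤ 1.105 * s := by
    rw [Real.sqrt_le_iff]
    refine ⟨by positivity, ?_⟩
    nlinarith
  have hlogs : Real.log s ≤ s / 8192 + 8.02 := by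
    have h6 := Real.log_le_sub_one_of_pos (x := s / 8192) (by positivity)
    rw [Real.log_div (by positivity) (by norm_num),
      show (8192 : ℝ) = 2 ^ 13 by norm_num, Real.log_pow] at h6
    have := Real.log_two_lt_d9
    norm_num at h6 ⊢
    linarith
  have hlogM : Real.log M ≤ s / 4096 + 16.26 := by
    have h6 : Real.log M ≤ Real.log (1.22 * s ^ 2) :=
      Real.log_le_log (by positivity) (by rw [hss]; exact hM1)
    rw [Real.log_mul (by norm_num) (by positivity), Real.log_pow] at h6
    have h7 := Real.log_le_sub_one_of_pos (x := 1.22) (by norm_num)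
    push_cast at h6
    linarith
  have hlogM0 : 0 ≤ Real.log M := Real.log_nonneg hMpos
  have h6 : √(M : ℝ) * Real.log M ≤ 1.105 * s * (s / 4096 + 16.26) :=
    mul_le_mul hsM hlogM hlogM0 (by positivity)
  have h7 : chebyshevConst * (1.22 * N - 1) ≤ chebyshevConst * M :=
    mul_le_mul_of_nonneg_left hM2 (by linarith)
  have h8 : 0.85 * (0.02 * N - 1) ≤ chebyshevConst * (0.02 * N - 1) :=
    mul_le_mul_of_nonneg_right hA (by linarith)
  have h9 : 5000 * s ≤ s ^ 2 := by nlinarith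
  have h10 : Chebyshev.psi M - Chebyshev.psi N ≤ 2 * (1.105 * s * (s / 4096 + 16.26)) := by
    linarith
  have h11 : 0.85 * (0.02 * s ^ 2 - 1) ≤ chebyshevConst * (0.02 * N - 1) := by rw [hss]; exact h8
  have h12 : 2 * (1.105 * s * (s / 4096 + 16.26)) ≤ 0.0006 * s ^ 2 + 36 * s := by nlinarith
  linarith

/-- Consecutive members of a chain with small ratio cover the interval they span. -/
theorem exists_mem_sq_of_isChain {l : List ℕ} {a b n : ℕ}
    (hl : (a :: l).IsChain fun p q ↦ 2 * q ^ 2 ≤ 3 * (p ^ 2 + 1)) (hb : b ∈ l) (han : a ^ 2 < n)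
    (hnb : n ≤ b ^ 2) : ∃ q ∈ l, n ≤ q ^ 2 ∧ 2 * q ^ 2 ≤ 3 * n := by
  induction l generalizing a with
  | nil => simp at hb
  | cons c l ih =>
    rw [List.isChain_cons_cons] at hl
    rcases le_or_gt n (c ^ 2) with h | h
    · exact ⟨c, by simp, h, by omega⟩
    · have hbl : b ∈ l := by
        rcases List.mem_cons.mp hb with rfl | hb
        · omega
        · exact hb
      obtain ⟨q, hq, hq'⟩ := ih hl.2 hbl h
      exact ⟨q, List.mem_cons_of_mem c hq, hq'⟩

theorem exists_prime_sq_of_le {n : ℕ} (hn : 576 < n) (hn' : n ≤ 26750903 ^ 2) :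
    ∃ p, p.Prime ∧ n ≤ p ^ 2 ∧ 2 * p ^ 2 ≤ 3 * n := by
  obtain ⟨q, hq, h⟩ := exists_mem_sq_of_isChain (a := 24) (b := 26750903) (n := n)
    (l := [29, 31, 37, 43, 47, 53, 61, 73, 89, 109, 131, 157, 191, 233, 283, 337, 409, 499, 607,
      743, 907, 1109, 1327, 1621, 1979, 2423, 2963, 3623, 4423, 5417, 6619, 8101, 9907, 12119,
      14831, 18149, 22193, 27179, 33287, 40763, 49921, 61129, 74861, 91673, 112261, 137491, 168391,
      206233, 252559, 309317, 378823, 463949, 568207, 695899, 852289, 1043831, 1278419, 1565737,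
      1917623, 2348597, 2876411, 3522863, 4314587, 5284193, 6471749, 7926241, 9707623, 11889343,
      14561411, 17833957, 21842027, 26750903]) (by decide +kernel) (by decide +kernel) hn hn'
  refine ⟨q, ?_, h⟩
  clear h hn hn'
  revert q
  simp only [List.forall_mem_cons]
  norm_num

theorem exists_prime_sq {n : ℕ} (hn : 576 < n) :
    ∃ p, p.Prime ∧ n ≤ p ^ 2 ∧ 2 * p ^ 2 ≤ 3 * n := by
  rcases le_or_gt n (26750903 ^ 2) with h | h
  · exact exists_prime_sq_of_le hn h
  · have h1 : 25000000 ≤ n.sqrt := Nat.le_sqrt.mpr (by omega)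
    obtain ⟨p, hp, hlt, hle⟩ := exists_prime_le_mul_of_large h1
    have h2 : n < (n.sqrt + 1) ^ 2 := Nat.lt_succ_sqrt' n
    have h3 : n.sqrt ^ 2 ≤ n := Nat.sqrt_le' n
    exact ⟨p, hp, by nlinarith, by nlinarith⟩

/-- If `p ≠ 3` is a prime with `n ≤ p ^ 2 ≤ 3 * n / 2`, then `n` has a representation with
`x + w = p`. -/
theorem exists_repr_of_prime {n p : ℕ} (hp : p.Prime) (hp3 : p ≠ 3) (h₁ : n ≤ p ^ 2)
    (h₂ : 2 * p ^ 2 ≤ 3 * n) :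
    ∃ x y z w : ℕ, n = x ^ 2 + y ^ 2 + z ^ 2 + 2 * w ^ 2 ∧ Nat.Prime (x + w) := by
  have hp3' : p % 3 = 1 ∨ p % 3 = 2 := by
    have : ¬ 3 ∣ p := fun h ↦ hp3 ((Nat.prime_dvd_prime_iff_eq Nat.prime_three hp).mp h).symm
    omega
  have hsq : p ^ 2 % 3 = 1 := by
    rcases hp3' with h | h <;> simp [Nat.pow_mod, h]
  obtain ⟨t, u, v, ht⟩ :=
    exists_eq_sq_add_three_mul_sq_add_three_mul_sq (m := 3 * n - 2 * p ^ 2) (by omega)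
  push_cast [Nat.cast_sub h₂] at ht
  have h₁' : (n : ℤ) ≤ p ^ 2 := by exact_mod_cast h₁
  obtain ⟨t, hdvd, ht⟩ : ∃ t : ℤ, (3 : ℤ) ∣ t + p ∧
      (3 * n - 2 * p ^ 2 : ℤ) = t ^ 2 + 3 * u ^ 2 + 3 * v ^ 2 := by
    have h : (3 : ℤ) ∣ (t + p) * (-t + p) :=
      ⟨p ^ 2 - n + u ^ 2 + v ^ 2, by linear_combination ht⟩
    rcases Int.prime_three.dvd_or_dvd h with h | h
    · exact ⟨t, h, ht⟩
    · exact ⟨-t, h, by rw [ht]; ring⟩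
  obtain ⟨w, hw⟩ := hdvd
  obtain rfl : t = 3 * w - p := by linarith
  obtain ⟨hlo, hhi⟩ : -(p : ℤ) ≤ 3 * w - p ∧ 3 * w - p ≤ p :=
    abs_le.mp (abs_le_of_sq_le_sq (by nlinarith [sq_nonneg u, sq_nonneg v]) (by positivity))
  lift w to ℕ using by linarith
  obtain ⟨x, hx⟩ : ∃ x : ℕ, x + w = p := ⟨p - w, by omega⟩
  refine ⟨x, u.natAbs, v.natAbs, w, ?_, hx ▸ hp⟩
  subst hx
  zify
  rw [sq_abs, sq_abs]
  push_cast at ht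
  linarith

theorem small_values_check : (List.range 577).all fun n ↦ n ≤ 2 ||
    [2, 5, 7, 11, 13, 17, 19, 23].any (fun p ↦ n ≤ p ^ 2 && 2 * p ^ 2 ≤ 3 * n) ||
    [2, 3, 5, 7, 11, 13, 17, 19, 23].any fun p ↦ (List.range (p + 1)).any fun w ↦
      (List.range 24).any fun y ↦ (List.range (y + 1)).any fun z ↦
        n == (p - w) ^ 2 + y ^ 2 + z ^ 2 + 2 * w ^ 2 := by
  decide +kernel

theorem exists_repr_of_lt {n : ℕ} (hn : 2 < n) (hn' : n < 577) :
    ∃ x y z w : ℕ, n = x ^ 2 + y ^ 2 + z ^ 2 + 2 * w ^ 2 ∧ Nat.Prime (x + w) := by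
  have h := List.all_eq_true.mp small_values_check n (List.mem_range.mpr hn')
  simp only [Bool.or_eq_true, Bool.and_eq_true, decide_eq_true_eq, List.any_eq_true,
    List.mem_range, beq_iff_eq, hn.not_ge, false_or] at h
  rcases h with ⟨p, hp, h₁, h₂⟩ | ⟨p, hp, w, hw, y, -, z, -, h⟩
  · have hpp : p.Prime ∧ p ≠ 3 := by
      clear h₁ h₂
      revert p
      simp only [List.forall_mem_cons]
      norm_num
    exact exists_repr_of_prime hpp.1 hpp.2 h₁ h₂
  · refine ⟨p - w, y, z, w, h, ?_⟩
    rw [Nat.sub_add_cancel (by omega)]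
    clear h hw
    revert p
    simp only [List.forall_mem_cons]
    norm_num

theorem sums_of_squares_x_plus_w_prime (n : ℕ) (hn : 2 < n) :
    ∃ x y z w : ℕ,
      n = x ^ 2 + y ^ 2 + z ^ 2 + 2 * w ^ 2 ∧ Nat.Prime (x + w) := by
  rcases lt_or_ge n 577 with h | h
  · exact exists_repr_of_lt hn h
  · obtain ⟨p, hp, h₁, h₂⟩ := exists_prime_sq h
    exact exists_repr_of_prime hp (by rintro rfl; omega) h₁ h₂
end

section
/- Let λ be a positive odd integer. Then every integer n ≥ λ^2/8 can be written as n = x^2 + y^2 + z^2 + 2w^2 with integers x, y, z, w satisfying x + y + 2z + 2w = λ. -/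
/-- A positive definite binary form `A x² + 2 B x y + C y²` properly represents a positive value
`N` with `3 N² ≤ 4 (A C - B²)`. -/
theorem exists_unimodular_small_value (A B C : ℤ) (hA : 0 < A) (hD : 0 < A * C - B ^ 2) :
    ∃ p q r s : ℤ, p * s - q * r = 1 ∧ 0 < A * p ^ 2 + 2 * B * p * r + C * r ^ 2 ∧
      3 * (A * p ^ 2 + 2 * B * p * r + C * r ^ 2) ^ 2 ≤ 4 * (A * C - B ^ 2) := by
  induction hk : A.toNat using Nat.strong_induction_on generalizing A B C with
  | _ k ih =>
    obtain ⟨t, ht1, ht2⟩ : ∃ t : ℤ, 2 * (B + t * A) ≤ A ∧ -A ≤ 2 * (B + t * A) := by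
      refine ⟨-((2 * B + A) / (2 * A)), ?_, ?_⟩
      · linarith [Int.lt_ediv_add_one_mul_self (2 * B + A) (show 0 < 2 * A by lia)]
      · linarith [Int.ediv_mul_le (2 * B + A) (show 2 * A ≠ 0 by lia)]
    obtain ⟨B', hB'⟩ : ∃ B', B' = B + t * A := ⟨_, rfl⟩
    obtain ⟨C', hC'⟩ : ∃ C', C' = C + 2 * t * B + t ^ 2 * A := ⟨_, rfl⟩
    rw [← hB'] at ht1 ht2
    have hdet : A * C' - B' ^ 2 = A * C - B ^ 2 := by subst hB' hC'; ring
    have hB2 : 4 * B' ^ 2 ≤ A ^ 2 := by nlinarith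
    by_cases hAC : A ≤ C'
    · refine ⟨1, 0, 0, 1, by ring, by simpa using hA, ?_⟩
      rw [← hdet]
      nlinarith
    · have hC0 : 0 < C' := by
        by_contra! h
        nlinarith [sq_nonneg B']
      obtain ⟨p, q, r, s, h1, h2, h3⟩ :=
        ih C'.toNat (by lia) C' (-B') A hC0 (by linarith) rfl
      have hval : A * (t * p - r) ^ 2 + 2 * B * (t * p - r) * p + C * p ^ 2 =
          C' * p ^ 2 + 2 * (-B') * p * r + A * r ^ 2 := by subst hB' hC'; ring
      refine ⟨t * p - r, t * q - s, p, q, by linarith, by rwa [hval], ?_⟩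
      rw [hval, ← hdet]
      linarith

/-- The values of a positive definite integral binary form of determinant `1` are sums of
two squares. -/
theorem binary_det_one_sum_two_squares (A B C : ℤ) (hA : 0 < A) (hD : A * C - B ^ 2 = 1)
    (x y : ℤ) : ∃ u v : ℤ, A * x ^ 2 + 2 * B * x * y + C * y ^ 2 = u ^ 2 + v ^ 2 := by
  obtain ⟨p, q, r, s, h1, h2, h3⟩ := exists_unimodular_small_value A B C hA (by lia)
  rw [hD] at h3
  have hN : A * p ^ 2 + 2 * B * p * r + C * r ^ 2 = 1 := by nlinarith
  set M := A * p * q + B * (p * s + q * r) + C * r * s with hM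
  set K := A * q ^ 2 + 2 * B * q * s + C * s ^ 2 with hK
  have hdet : K - M ^ 2 = 1 := by
    have : (A * p ^ 2 + 2 * B * p * r + C * r ^ 2) * K - M ^ 2 =
      (A * C - B ^ 2) * (p * s - q * r) ^ 2 := by rw [hM, hK]; ring
    rw [hN, hD, h1] at this
    linarith
  obtain ⟨x', hx'⟩ : ∃ x', x' = s * x - q * y := ⟨_, rfl⟩
  obtain ⟨y', hy'⟩ : ∃ y', y' = -r * x + p * y := ⟨_, rfl⟩
  have hx : x = p * x' + q * y' := by subst hx' hy'; linear_combination (-x) * h1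
  have hy : y = r * x' + s * y' := by subst hx' hy'; linear_combination (-y) * h1
  refine ⟨x' + M * y', y', ?_⟩
  rw [hx, hy]
  linear_combination x' ^ 2 * hN + y' ^ 2 * hdet

/-- The values of a positive definite integral ternary form of determinant `1` are sums of
three squares. -/
theorem ternary_det_one_sum_three_squares (a b c d e f : ℤ) (ha : 0 < a)
    (hD : 0 < a * b - d ^ 2)
    (hdet : a * b * c + 2 * d * e * f - a * f ^ 2 - b * e ^ 2 - c * d ^ 2 = 1) (x y z : ℤ) :
    ∃ u v w : ℤ, a * x ^ 2 + b * y ^ 2 + c * z ^ 2 + 2 * d * x * y + 2 * e * x * z +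
      2 * f * y * z = u ^ 2 + v ^ 2 + w ^ 2 := by
  induction hk : a.toNat using Nat.strong_induction_on generalizing a b c d e f x y z with
  | _ k ih =>
    have hG : (a * b - d ^ 2) * (a * c - e ^ 2) - (a * f - d * e) ^ 2 = a := by
      linear_combination a * hdet
    obtain ⟨p, q, r, s, h1, h2, h3⟩ :=
      exists_unimodular_small_value (a * b - d ^ 2) (a * f - d * e) (a * c - e ^ 2) hD (by lia)
    obtain ⟨N, hN⟩ : ∃ N, N = (a * b - d ^ 2) * p ^ 2 + 2 * (a * f - d * e) * p * r +
      (a * c - e ^ 2) * r ^ 2 := ⟨_, rfl⟩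
    rw [hG, ← hN] at h3
    rw [← hN] at h2
    obtain ⟨t, ht1, ht2⟩ : ∃ t : ℤ, 2 * (d * p + e * r + t * a) ≤ a ∧
        -a ≤ 2 * (d * p + e * r + t * a) := by
      refine ⟨-((2 * (d * p + e * r) + a) / (2 * a)), ?_, ?_⟩
      · linarith [Int.lt_ediv_add_one_mul_self (2 * (d * p + e * r) + a)
          (show 0 < 2 * a by lia)]
      · linarith [Int.ediv_mul_le (2 * (d * p + e * r) + a) (show 2 * a ≠ 0 by lia)]
    obtain ⟨d', hd'⟩ : ∃ d', d' = d * p + e * r + t * a := ⟨_, rfl⟩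
    obtain ⟨b', hb'⟩ : ∃ b', b' = b * p ^ 2 + 2 * f * p * r + c * r ^ 2 +
      2 * t * (d * p + e * r) + t ^ 2 * a := ⟨_, rfl⟩
    rw [← hd'] at ht1 ht2
    have hN' : a * b' - d' ^ 2 = N := by rw [hN, hd', hb']; ring
    have hd2 : 4 * d' ^ 2 ≤ a ^ 2 := by
      have := mul_nonneg (sub_nonneg.mpr ht1) (neg_le_iff_add_nonneg.mp ht2)
      linarith
    by_cases hab : a ≤ b'
    · have h4 : 3 * a ^ 2 ≤ 4 * N := by
        have := mul_le_mul_of_nonneg_left hab ha.le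
        linarith
      have h5 : (3 * a ^ 2) ^ 2 ≤ (4 * N) ^ 2 := by gcongr
      have ha1 : a = 1 := by
        clear * - ha h3 h5
        by_contra hne
        have ha2 : 2 ≤ a := by lia
        have h8 : 2 ^ 3 ≤ a ^ 3 := by gcongr
        have h6 : a * (27 * a ^ 3 - 64) ≤ 0 := by linarith
        have h7 : 0 < a * (27 * a ^ 3 - 64) := mul_pos ha (by linarith)
        linarith
      subst ha1
      obtain ⟨v, w, hvw⟩ := binary_det_one_sum_two_squares _ _ _ hD hG y z
      exact ⟨x + d * y + e * z, v, w, by linear_combination hvw⟩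
    · have hb0 : 0 < b' := by
        refine pos_of_mul_pos_right (a := a) ?_ ha.le
        linarith [sq_nonneg d']
      obtain ⟨e', he'⟩ : ∃ e', e' = d * q + e * s := ⟨_, rfl⟩
      obtain ⟨c', hc'⟩ : ∃ c', c' = b * q ^ 2 + 2 * f * q * s + c * s ^ 2 := ⟨_, rfl⟩
      obtain ⟨f', hf'⟩ : ∃ f', f' = b * p * q + f * (p * s + q * r) + c * r * s + t * e' :=
        ⟨_, rfl⟩
      have hdet' : b' * a * c' + 2 * d' * f' * e' - b' * e' ^ 2 - a * f' ^ 2 - c' * d' ^ 2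
          = 1 := by
        have : b' * a * c' + 2 * d' * f' * e' - b' * e' ^ 2 - a * f' ^ 2 - c' * d' ^ 2 =
            (a * b * c + 2 * d * e * f - a * f ^ 2 - b * e ^ 2 - c * d ^ 2) *
              (p * s - q * r) ^ 2 := by
          rw [hf', hb', hc', hd', he']; ring
        rw [this, hdet, h1]; norm_num
      obtain ⟨y', hy'⟩ : ∃ y', y' = s * y - q * z := ⟨_, rfl⟩
      obtain ⟨z', hz'⟩ : ∃ z', z' = -r * y + p * z := ⟨_, rfl⟩
      have hy : y = p * y' + q * z' := by subst hy' hz'; linear_combination (-y) * h1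
      have hz : z = r * y' + s * z' := by subst hy' hz'; linear_combination (-z) * h1
      obtain ⟨u, v, w, huvw⟩ := ih b'.toNat (by lia) b' a c' d' f' e' hb0 (by linarith)
        (by linarith) y' (x - t * y') z' rfl
      refine ⟨u, v, w, ?_⟩
      rw [← huvw, hf', hb', hc', hd', he', hy, hz]
      ring

/-- For `n ≡ 2 mod 4` there is `d > 0` such that `-d` is a square modulo `d n - 1`. -/
theorem exists_neg_square_mod_mul_sub_one (n : ℕ) (hn : n % 4 = 2) :
    ∃ d p a h : ℤ, 0 < d ∧ 0 < a ∧ p = d * n - 1 ∧ a * p = h ^ 2 + d := by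
  have hcop : (n - 1).Coprime (4 * n) := by
    have h1 : (n - 1).Coprime n := by
      have := Nat.coprime_self_add_right (m := n - 1) (n := 1)
      rw [show n - 1 + 1 = n by lia] at this
      simpa using this
    have h2 : (n - 1).Coprime (2 ^ 2) :=
      Nat.Coprime.pow_right 2 (Nat.coprime_two_right.mpr (Nat.odd_iff.mpr (by lia)))
    exact Nat.Coprime.mul_right h2 h1
  obtain ⟨p, hpn, hp, hmod⟩ :=
    Nat.forall_exists_prime_gt_and_modEq (n - 1) (q := 4 * n) (by lia) hcop
  obtain ⟨j, hj⟩ := (Nat.modEq_iff_dvd' hpn.le).mp hmod.symm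
  have hpd : p + 1 = (4 * j + 1) * n := by
    have h1 : p + 1 = 4 * n * j + n := by lia
    rw [h1]; ring
  have hp4 : p % 4 = 1 := by
    have : p = 4 * (n * j) + (n - 1) := by
      have : 4 * n * j = 4 * (n * j) := by ring
      lia
    lia
  have hpd' : (p : ℤ) = (4 * j + 1 : ℕ) * n - 1 := by
    have : ((p + 1 : ℕ) : ℤ) = ((4 * j + 1) * n : ℕ) := by rw [hpd]
    push_cast at this ⊢
    linarith
  have := Fact.mk hp
  have hodd : Odd (4 * j + 1) := Nat.odd_iff.mpr (by lia)
  have hjac : jacobiSym (-((4 * j + 1 : ℕ) : ℤ)) p = 1 := by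
    rw [jacobiSym.neg _ (Nat.odd_iff.mpr (by lia)), ZMod.χ₄_nat_one_mod_four hp4, one_mul,
      jacobiSym.quadratic_reciprocity_one_mod_four' hodd hp4,
      jacobiSym.mod_left' (a₂ := -1), jacobiSym.at_neg_one hodd,
      ZMod.χ₄_nat_one_mod_four (by lia)]
    rw [hpd']
    exact Int.modEq_iff_dvd.mpr ⟨-n, by ring⟩
  obtain ⟨y, hy⟩ := ZMod.isSquare_of_jacobiSym_eq_one hjac
  have hdvd : (p : ℤ) ∣ (y.val : ℤ) ^ 2 + (4 * j + 1 : ℕ) := by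
    rw [← ZMod.intCast_zmod_eq_zero_iff_dvd]
    push_cast at hy ⊢
    rw [ZMod.natCast_zmod_val, pow_two, ← hy]
    ring
  obtain ⟨a, ha⟩ := hdvd
  have hp0 : (0 : ℤ) < p := by exact_mod_cast hp.pos
  have ha0 : 0 < a := by
    have : 0 < (p : ℤ) * a := by rw [← ha]; positivity
    exact pos_of_mul_pos_right this hp0.le
  exact ⟨(4 * j + 1 : ℕ), p, a, y.val, by positivity, ha0, hpd', by linarith⟩

/-- Every natural number congruent to `2` modulo `4` is a sum of three squares. -/
theorem sum_three_squares_of_mod_four_eq_two (n : ℕ) (hn : n % 4 = 2) :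
    ∃ u v w : ℤ, (n : ℤ) = u ^ 2 + v ^ 2 + w ^ 2 := by
  obtain ⟨d, p, a, h, hd, ha, hp, hah⟩ := exists_neg_square_mod_mul_sub_one n hn
  obtain ⟨u, v, w, huvw⟩ := ternary_det_one_sum_three_squares a p n h 1 0 ha (by lia)
    (by linear_combination n * hah - hp) 0 0 1
  exact ⟨u, v, w, by linarith⟩

theorem sq_emod_eight_of_odd {t : ℤ} (ht : Odd t) : t ^ 2 % 8 = 1 := by
  have := Int.eight_dvd_sq_sub_one_of_odd ht
  lia

/-- Every positive integer congruent to `7` modulo `8` has the form `4 A² + 2 B² + C²` with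
`A`, `B`, `C` odd. -/
theorem exists_odd_repr_of_mod_eight_eq_seven (m : ℤ) (hm : 0 < m) (hm8 : m % 8 = 7) :
    ∃ A B C : ℤ, A % 2 = 1 ∧ B % 2 = 1 ∧ C % 2 = 1 ∧
      m = 4 * A ^ 2 + 2 * B ^ 2 + C ^ 2 := by
  obtain ⟨u, v, w, h⟩ := sum_three_squares_of_mod_four_eq_two (2 * m).toNat (by lia)
  rw [Int.toNat_of_nonneg (by lia)] at h
  have two_odd : ∀ u v w : ℤ, u % 2 = 1 → v % 2 = 1 → w % 2 = 0 →
      2 * m = u ^ 2 + v ^ 2 + w ^ 2 → ∃ A B C : ℤ, A % 2 = 1 ∧ B % 2 = 1 ∧ C % 2 = 1 ∧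
      m = 4 * A ^ 2 + 2 * B ^ 2 + C ^ 2 := by
    intro u v w hu hv hw h
    obtain ⟨r, hr⟩ : ∃ r, u = v + 2 * r := ⟨(u - v) / 2, by lia⟩
    obtain ⟨B, hB⟩ : ∃ B, w = 2 * B := ⟨w / 2, by lia⟩
    have key : ∀ A C : ℤ, m = 4 * A ^ 2 + 2 * B ^ 2 + C ^ 2 →
        A % 2 = 1 ∧ B % 2 = 1 ∧ C % 2 = 1 := by
      intro A C h
      have sq8 : ∀ t : ℤ, t % 2 = 1 ∧ t ^ 2 % 8 = 1 ∨ t % 2 = 0 ∧ t ^ 2 % 4 = 0 := by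
        intro t
        rcases Int.emod_two_eq_zero_or_one t with ht | ht
        · exact Or.inr ⟨ht, by
            obtain ⟨k, rfl⟩ : ∃ k, t = 2 * k := ⟨t / 2, by lia⟩
            ring_nf; lia⟩
        · exact Or.inl ⟨ht, sq_emod_eight_of_odd (Int.odd_iff.mpr ht)⟩
      rcases sq8 A with hA | hA <;> rcases sq8 B with hB | hB <;>
        rcases sq8 C with hC | hC <;> lia
    have hm' : m = r ^ 2 + 2 * B ^ 2 + (v + r) ^ 2 := by subst hr hB; linarith
    rcases Int.emod_two_eq_zero_or_one r with hr2 | hr2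
    · obtain ⟨A, rfl⟩ : ∃ A, r = 2 * A := ⟨r / 2, by lia⟩
      have hrep : m = 4 * A ^ 2 + 2 * B ^ 2 + (v + 2 * A) ^ 2 := by linarith
      obtain ⟨h1, h2, h3⟩ := key _ _ hrep
      exact ⟨_, _, _, h1, h2, h3, hrep⟩
    · obtain ⟨A, hA⟩ : ∃ A, v + r = 2 * A := ⟨(v + r) / 2, by lia⟩
      have hrep : m = 4 * A ^ 2 + 2 * B ^ 2 + r ^ 2 := by rw [hA] at hm'; linarith
      obtain ⟨h1, h2, h3⟩ := key _ _ hrep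
      exact ⟨_, _, _, h1, h2, h3, hrep⟩
  have sq4 : ∀ t : ℤ, t % 2 = 1 ∧ t ^ 2 % 4 = 1 ∨ t % 2 = 0 ∧ t ^ 2 % 4 = 0 := by
    intro t
    rcases Int.emod_two_eq_zero_or_one t with ht | ht
    · exact Or.inr ⟨ht, by
        obtain ⟨k, rfl⟩ : ∃ k, t = 2 * k := ⟨t / 2, by lia⟩
        ring_nf; lia⟩
    · exact Or.inl ⟨ht, Int.sq_mod_four_eq_one_of_odd (Int.odd_iff.mpr ht)⟩
  rcases sq4 u with hu | hu <;> rcases sq4 v with hv | hv <;> rcases sq4 w with hw | hw <;>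
    first
    | exact two_odd u v w (by lia) (by lia) (by lia) h
    | exact two_odd u w v (by lia) (by lia) (by lia) (by linarith)
    | exact two_odd v w u (by lia) (by lia) (by lia) (by linarith)

theorem repr_with_linear_form_1122 (lam : ℤ) (hpos : 0 < lam) (hodd : Odd lam)
    (n : ℤ) (hn : (n : ℝ) ≥ (lam : ℝ) ^ 2 / 8) :
    ∃ x y z w : ℤ,
      n = x ^ 2 + y ^ 2 + z ^ 2 + 2 * w ^ 2 ∧ x + y + 2 * z + 2 * w = lam := by
  have hn' : lam ^ 2 ≤ 8 * n := by
    have : (lam : ℝ) ^ 2 ≤ 8 * n := by linarith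
    exact_mod_cast this
  have hl8 : lam ^ 2 % 8 = 1 := sq_emod_eight_of_odd hodd
  have hl2 : lam % 2 = 1 := Int.odd_iff.mp hodd
  obtain ⟨A, B₀, C₀, hA, hB₀, hC₀, hm⟩ :=
    exists_odd_repr_of_mod_eight_eq_seven (8 * n - lam ^ 2) (by lia) (by lia)
  obtain ⟨C, hC, z, hz⟩ : ∃ C, C ^ 2 = C₀ ^ 2 ∧ ∃ z, lam = C + 4 * z := by
    rcases (by lia : (lam - C₀) % 4 = 0 ∨ (lam + C₀) % 4 = 0) with h | h
    · exact ⟨C₀, rfl, (lam - C₀) / 4, by lia⟩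
    · exact ⟨-C₀, by ring, (lam + C₀) / 4, by lia⟩
  have hC2 : C % 2 = 1 := by lia
  obtain ⟨B, hB, w, hw⟩ : ∃ B, B ^ 2 = B₀ ^ 2 ∧ ∃ w, C + 2 * z = B + 4 * w := by
    rcases (by lia : (C + 2 * z - B₀) % 4 = 0 ∨ (C + 2 * z + B₀) % 4 = 0) with h | h
    · exact ⟨B₀, rfl, (C + 2 * z - B₀) / 4, by lia⟩
    · exact ⟨-B₀, by ring, (C + 2 * z + B₀) / 4, by lia⟩
  have hB2 : B % 2 = 1 := by lia
  obtain ⟨y, hy⟩ : ∃ y, B + 2 * w = A + 2 * y := ⟨(B + 2 * w - A) / 2, by lia⟩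
  refine ⟨A + y, y, z, w, ?_, by lia⟩
  have hBe : B = A + 2 * y - 2 * w := by lia
  have hCe : C = A + 2 * y + 2 * w - 2 * z := by lia
  have hle : lam = A + 2 * y + 2 * w + 2 * z := by lia
  rw [← hB, ← hC, hBe, hCe, hle] at hm
  linarith
end

section
/- Let λ be a positive odd integer. Then every integer n ≥ λ^2/16 can be written as n = x^2 + y^2 + z^2 + 2w^2 with integers x, y, z, w satisfying x + 2y + 3z + 2w = λ. -/
/-- Every integer can be translated by a multiple of `b > 0` into `[-b/2, b/2]`. -/
lemma exists_abs_two_mul_add_mul_le (h b : ℤ) (hb : 0 < b) :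
    ∃ k : ℤ, 4 * (h + k * b) ^ 2 ≤ b ^ 2 := by
  refine ⟨-((2 * h + b) / (2 * b)), ?_⟩
  have h1 := Int.emod_add_mul_ediv (2 * h + b) (2 * b)
  have h2 := Int.emod_nonneg (2 * h + b) (show 2 * b ≠ 0 by omega)
  have h3 := Int.emod_lt_of_pos (2 * h + b) (show 0 < 2 * b by omega)
  set q := (2 * h + b) / (2 * b)
  set r := (2 * h + b) % (2 * b)
  have h4 : 2 * (h + -q * b) = r - b := by linear_combination -h1
  nlinarith

/-- A positive definite integral ternary quadratic form with Gram determinant `1` represents only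
sums of three squares. -/
theorem exists_sum_three_sq_of_det_eq_one (a b c d e g : ℤ) (ha : 0 < a)
    (hB : 0 < a * b - d ^ 2)
    (hdet : a * b * c + 2 * d * e * g - a * g ^ 2 - b * e ^ 2 - c * d ^ 2 = 1) (x y z : ℤ) :
    ∃ p q r : ℤ, a * x ^ 2 + b * y ^ 2 + c * z ^ 2 + 2 * d * x * y + 2 * e * x * z + 2 * g * y * z
      = p ^ 2 + q ^ 2 + r ^ 2 := by
  by_cases hred : 3 * (a * b - d ^ 2) ^ 2 ≤ 4 * a
  · obtain ⟨k, hk⟩ := exists_abs_two_mul_add_mul_le d a ha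
    have hinv : a * (b + 2 * k * d + k ^ 2 * a) - (d + k * a) ^ 2 = a * b - d ^ 2 := by ring
    by_cases hlt : b + 2 * k * d + k ^ 2 * a < a
    · have hpos : 0 < b + 2 * k * d + k ^ 2 * a := by
        by_contra! hle
        nlinarith [sq_nonneg (d + k * a), mul_nonneg ha.le (sub_nonneg.2 hle)]
      obtain ⟨p, q, r, h⟩ := exists_sum_three_sq_of_det_eq_one
        (b + 2 * k * d + k ^ 2 * a) a c (d + k * a) (g + k * e) e hpos
        (by linarith [hinv]) (by linear_combination hdet) y (x - k * y) z
      exact ⟨p, q, r, by rw [← h]; ring⟩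
    · have ha1 : a = 1 := by
        have h1 : 3 * a ^ 2 ≤ 4 * (a * b - d ^ 2) := by nlinarith
        by_contra hne
        have h2 : 2 ≤ a := by omega
        have h3 : 9 * (a ^ 2) ^ 2 ≤ 16 * (a * b - d ^ 2) ^ 2 := by
          nlinarith [sq_nonneg a]
        have h4 : 8 * a ≤ (a ^ 2) ^ 2 := by
          nlinarith [mul_nonneg (sub_nonneg.2 h2) (sub_nonneg.2 h2), sq_nonneg a,
            pow_le_pow_left₀ (by norm_num) h2 3]
        linarith
      subst ha1
      have hB1 : 1 * b - d ^ 2 = 1 := by nlinarith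
      have hb : b = 1 + d ^ 2 := by linarith
      subst hb
      have hc : c = 1 + e ^ 2 + (g - d * e) ^ 2 := by linear_combination hdet
      subst hc
      exact ⟨x + d * y + e * z, y + (g - d * e) * z, z, by ring⟩
  · obtain ⟨k, hk⟩ := exists_abs_two_mul_add_mul_le (a * g - d * e) (a * b - d ^ 2) hB
    have key : (a * b - d ^ 2) * (a * (c + 2 * k * g + k ^ 2 * b) - (e + k * d) ^ 2) =
        a + (a * g - d * e + k * (a * b - d ^ 2)) ^ 2 := by linear_combination a * hdet
    have hpos : 0 < a * (c + 2 * k * g + k ^ 2 * b) - (e + k * d) ^ 2 := by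
      refine pos_of_mul_pos_right ?_ hB.le
      rw [key]
      positivity
    have hlt : a * (c + 2 * k * g + k ^ 2 * b) - (e + k * d) ^ 2 < a * b - d ^ 2 := by
      by_contra! hle
      nlinarith [mul_le_mul_of_nonneg_left hle hB.le]
    obtain ⟨p, q, r, h⟩ := exists_sum_three_sq_of_det_eq_one
      a (c + 2 * k * g + k ^ 2 * b) b (e + k * d) d (g + k * b) ha hpos
      (by linear_combination hdet) x z (y - k * z)
    exact ⟨p, q, r, by rw [← h]; ring⟩
termination_by (a.toNat, (a * b - d ^ 2).toNat)
decreasing_by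
  · exact Prod.Lex.left _ _ (by omega)
  · exact Prod.Lex.right _ ((Int.toNat_lt_toNat hB).2 hlt)

/-- Every natural number congruent to `2` modulo `4` is a sum of three squares. -/
theorem Nat.exists_sum_three_sq_of_mod_four_eq_two (N : ℕ) (hN : N % 4 = 2) :
    ∃ p q r : ℤ, (N : ℤ) = p ^ 2 + q ^ 2 + r ^ 2 := by
  obtain ⟨P, hgt, hP, hmod⟩ : ∃ P > N, P.Prime ∧ P ≡ N - 1 [MOD 4 * N] := by
    refine Nat.forall_exists_prime_gt_and_modEq N (by omega) ?_
    refine Nat.Coprime.mul_right ?_ ?_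
    · exact Nat.Coprime.pow_right 2 (Nat.coprime_two_right.2 (Nat.odd_iff.2 (by omega)))
    · exact (Nat.coprime_self_sub_left (by omega : 1 ≤ N)).2 (Nat.coprime_one_left N)
  obtain ⟨j, hj⟩ := (Nat.modEq_iff_dvd' (by omega)).1 hmod.symm
  have hP' : P + 1 = (4 * j + 1) * N := by
    have : P = N - 1 + 4 * N * j := by omega
    zify [show 1 ≤ N by omega] at this ⊢
    linear_combination this
  have hP4 : P % 4 = 1 := by
    have : (P + 1) % 4 = 2 := by rw [hP', Nat.mul_mod]; simp [hN, Nat.add_mod]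
    omega
  have : Fact P.Prime := ⟨hP⟩
  have hodd : Odd (4 * j + 1) := ⟨2 * j, by ring⟩
  have hJ : jacobiSym (-((4 * j + 1 : ℕ) : ℤ)) P = 1 := by
    rw [jacobiSym.neg _ (Nat.odd_iff.2 (by omega)), ZMod.χ₄_nat_one_mod_four hP4, one_mul,
      jacobiSym.quadratic_reciprocity_one_mod_four (by omega) (Nat.odd_iff.2 (by omega)),
      jacobiSym.mod_left' (a₂ := -1), jacobiSym.at_neg_one hodd,
      ZMod.χ₄_nat_one_mod_four (by omega)]
    refine (Int.modEq_iff_dvd.2 ⟨-N, ?_⟩ : (P : ℤ) ≡ -1 [ZMOD (4 * j + 1 : ℕ)])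
    zify at hP'
    push_cast
    linear_combination -hP'
  obtain ⟨l, A, hl⟩ : ∃ l A : ℤ, l ^ 2 + (4 * j + 1) = P * A := by
    obtain ⟨t, ht⟩ := ZMod.isSquare_of_jacobiSym_eq_one hJ
    obtain ⟨l, rfl⟩ := ZMod.intCast_surjective t
    obtain ⟨A, hA⟩ := (ZMod.intCast_zmod_eq_zero_iff_dvd (l ^ 2 + (4 * j + 1)) P).1 (by
      push_cast at ht ⊢
      linear_combination -ht)
    exact ⟨l, A, hA⟩
  have hA : 0 < A := by
    have : 0 < (P : ℤ) * A := by rw [← hl]; positivity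
    exact pos_of_mul_pos_right this (by positivity)
  zify at hP'
  obtain ⟨p, q, r, h⟩ := exists_sum_three_sq_of_det_eq_one A P N l 1 0 hA
    (by have : A * P - l ^ 2 = 4 * j + 1 := by linear_combination -hl
        rw [this]; positivity)
    (by linear_combination -N * hl - hP') 0 0 1
  exact ⟨p, q, r, by rw [← h]; ring⟩

lemma Int.odd_and_sq_emod_or_even_and_sq_emod (t : ℤ) :
    Odd t ∧ t ^ 2 % 8 = 1 ∨ Even t ∧ t ^ 2 % 4 = 0 := by
  rcases Int.even_or_odd t with ht | ht
  · obtain ⟨s, rfl⟩ := ht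
    exact Or.inr ⟨⟨s, rfl⟩, by ring_nf; omega⟩
  · have := Int.eight_dvd_sq_sub_one_of_odd ht
    exact Or.inl ⟨ht, by omega⟩

/-- Every positive integer congruent to `3` modulo `4` has the form `A² + B² + 2C²`. -/
theorem exists_sq_add_sq_add_two_mul_sq_of_emod_four_eq_three (m : ℤ) (hm : 0 < m)
    (hm4 : m % 4 = 3) : ∃ A B C : ℤ, m = A ^ 2 + B ^ 2 + 2 * C ^ 2 := by
  have sorted : ∀ p q r : ℤ, Odd p → Odd q → Even r → 2 * m = p ^ 2 + q ^ 2 + r ^ 2 →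
      ∃ A B C : ℤ, m = A ^ 2 + B ^ 2 + 2 * C ^ 2 := by
    rintro _ _ _ ⟨p, rfl⟩ ⟨q, rfl⟩ ⟨r, rfl⟩ h
    exact ⟨p + q + 1, p - q, r, by linarith⟩
  obtain ⟨p, q, r, h⟩ := Nat.exists_sum_three_sq_of_mod_four_eq_two (2 * m).toNat (by omega)
  rw [Int.toNat_of_nonneg (by omega)] at h
  rcases p.odd_and_sq_emod_or_even_and_sq_emod with ⟨hp, hp'⟩ | ⟨hp, hp'⟩ <;>
    rcases q.odd_and_sq_emod_or_even_and_sq_emod with ⟨hq, hq'⟩ | ⟨hq, hq'⟩ <;>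
    rcases r.odd_and_sq_emod_or_even_and_sq_emod with ⟨hr, hr'⟩ | ⟨hr, hr'⟩ <;> try omega
  · exact sorted p q r hp hq hr h
  · exact sorted p r q hp hr hq (by linarith)
  · exact sorted q r p hq hr hp (by linarith)

/-- Every positive integer congruent to `7` modulo `8` has the form `A² + (2b)² + 2C²` with `A`, `b`
and `C` odd. -/
theorem exists_odd_sq_add_sq_add_two_mul_sq_of_emod_eight_eq_seven (m : ℤ) (hm : 0 < m)
    (hm8 : m % 8 = 7) :
    ∃ A b C : ℤ, Odd A ∧ Odd b ∧ Odd C ∧ m = A ^ 2 + (2 * b) ^ 2 + 2 * C ^ 2 := by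
  have sorted : ∀ A B C : ℤ, Odd A → Even B → m = A ^ 2 + B ^ 2 + 2 * C ^ 2 →
      ∃ A b C : ℤ, Odd A ∧ Odd b ∧ Odd C ∧ m = A ^ 2 + (2 * b) ^ 2 + 2 * C ^ 2 := by
    rintro A _ C hA ⟨b, rfl⟩ h
    have hA' := Int.eight_dvd_sq_sub_one_of_odd hA
    have hb : (b + b) ^ 2 = 4 * b ^ 2 := by ring
    rcases b.odd_and_sq_emod_or_even_and_sq_emod with ⟨hb, hb'⟩ | ⟨hb, hb'⟩ <;>
      rcases C.odd_and_sq_emod_or_even_and_sq_emod with ⟨hC, hC'⟩ | ⟨hC, hC'⟩ <;> try omega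
    exact ⟨A, b, C, hA, hb, hC, by rw [h]; ring⟩
  obtain ⟨A, B, C, h⟩ :=
    exists_sq_add_sq_add_two_mul_sq_of_emod_four_eq_three m hm (by omega)
  rcases A.odd_and_sq_emod_or_even_and_sq_emod with ⟨hA, hA'⟩ | ⟨hA, hA'⟩ <;>
    rcases B.odd_and_sq_emod_or_even_and_sq_emod with ⟨hB, hB'⟩ | ⟨hB, hB'⟩ <;> try omega
  · exact sorted A B C hA hB h
  · exact sorted B A C hB hA (by linarith)

lemma Int.exists_sq_eq_four_mul_sub_sq {A l : ℤ} (hA : Odd A) (hl : Odd l) :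
    ∃ a : ℤ, A ^ 2 = (4 * a - l) ^ 2 := by
  have h : (4 : ℤ) ∣ A + l ∨ (4 : ℤ) ∣ l - A := by
    rw [Int.odd_iff] at hA hl
    omega
  rcases h with ⟨a, ha⟩ | ⟨a, ha⟩
  · exact ⟨a, by rw [← ha]; ring⟩
  · exact ⟨a, by rw [← ha]; ring⟩

theorem repr_with_linear_form_1232 (lam : ℤ) (hpos : 0 < lam) (hodd : Odd lam)
    (n : ℤ) (hn : (n : ℝ) ≥ (lam : ℝ) ^ 2 / 16) :
    ∃ x y z w : ℤ,
      n = x ^ 2 + y ^ 2 + z ^ 2 + 2 * w ^ 2 ∧ x + 2 * y + 3 * z + 2 * w = lam := by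
  have hn' : lam ^ 2 ≤ 16 * n := by
    have : (lam : ℝ) ^ 2 ≤ 16 * n := by linarith
    exact_mod_cast this
  have hl8 := Int.eight_dvd_sq_sub_one_of_odd hodd
  obtain ⟨A, b, C, hA, hb, hC, h⟩ :=
    exists_odd_sq_add_sq_add_two_mul_sq_of_emod_eight_eq_seven (16 * n - lam ^ 2)
      (by omega) (by omega)
  obtain ⟨a, ha⟩ := Int.exists_sq_eq_four_mul_sub_sq hA hodd
  obtain ⟨c, hc⟩ := Int.exists_sq_eq_four_mul_sub_sq hC hodd
  rw [ha, hc] at h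
  have ha_odd : Odd a := by
    have hb8 := Int.eight_dvd_sq_sub_one_of_odd hb
    have hal : Odd (a * lam) := by
      have : 16 * n = 16 * a ^ 2 - 8 * (a * lam) + 4 * b ^ 2 + 32 * c ^ 2 - 16 * (c * lam)
          + 4 * lam ^ 2 := by linear_combination h
      rw [Int.odd_iff]
      omega
    exact (Int.odd_mul.1 hal).1
  obtain ⟨β, hβ, k, hk⟩ : ∃ β : ℤ, β ^ 2 = b ^ 2 ∧ (4 : ℤ) ∣ a + 2 * c + β := by
    by_cases h4 : (4 : ℤ) ∣ a + 2 * c + b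
    · exact ⟨b, rfl, h4⟩
    · refine ⟨-b, by ring, ?_⟩
      rw [Int.odd_iff] at ha_odd hb
      omega
  obtain rfl : β = 4 * k - a - 2 * c := by linarith
  obtain ⟨y, hy⟩ : ∃ y : ℤ, lam = 2 * y + a + 2 * c := by
    refine ⟨(lam - a - 2 * c) / 2, ?_⟩
    rw [Int.odd_iff] at hodd ha_odd
    omega
  subst hy
  -- This is the reflection of `(A, 2β, lam, C) / 4` in the hyperplane orthogonal to `(1, 2, -1, 1)`.
  exact ⟨a - k, y, k, c - k, by linarith, by ring⟩
end
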